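/- arXiv:1007.0424 — 8 statements merged into one kernel-verified Lean document; each statement's English description precedes it below -/
import Mathlib

section
/- Let M₁,...,Mₘ be compact metric spaces equipped with Borel probability measures μ₁,...,μₘ, and let c : M₁×⋯×Mₘ → ℝ be continuous. Then the Kantorovich problem admits a solution: there exists a Borel probability measure μ on M₁×⋯×Mₘ whose pushforward under the i-th canonical projection equals μᵢ for every i, and which minimizes ∫ c dμ among all such measures. -/
open MeasureTheory

/-- The set of couplings of a family of probability measures on metric spaces is closed for the
weak topology. -/
theorem isClosed_setOf_forall_map_eval_eq {ι : Type*} [Countable ι] {M : ι → Type*}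
    [∀ i, MetricSpace (M i)] [∀ i, SecondCountableTopology (M i)] [∀ i, MeasurableSpace (M i)]
    [∀ i, BorelSpace (M i)] (μ : ∀ i, ProbabilityMeasure (M i)) :
    IsClosed {ν : ProbabilityMeasure (∀ i, M i) |
      ∀ i, (ν : Measure (∀ i, M i)).map (fun p => p i) = μ i} := by
  simp only [Set.ofPred_forall]
  refine isClosed_iInter fun i => ?_
  have h := isClosed_singleton (x := μ i) |>.preimage
    (ProbabilityMeasure.continuous_map (continuous_apply (A := M) i))
  convert h using 1
  ext ν
  exact (Subtype.coe_injective.eq_iff (a := ν.map _) (b := μ i))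

/-- **Existence of a solution to the multi-marginal Kantorovich problem.**
Given compact metric spaces `M i` with Borel probability measures `μ i` and a
continuous cost `c`, there is a Borel probability measure `π` on the product
whose `i`-th marginal is `μ i` for every `i` and which minimizes `∫ c dπ`
among all such measures. -/
theorem kantorovich_exists {m : ℕ} (M : Fin m → Type*) [∀ i, MetricSpace (M i)]
    [∀ i, CompactSpace (M i)] [∀ i, MeasurableSpace (M i)] [∀ i, BorelSpace (M i)]
    (μ : ∀ i, Measure (M i)) [∀ i, IsProbabilityMeasure (μ i)]
    (c : (∀ i, M i) → ℝ) (hc : Continuous c) :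
    ∃ π : Measure (∀ i, M i), IsProbabilityMeasure π ∧
      (∀ i, π.map (fun p => p i) = μ i) ∧
      ∀ π' : Measure (∀ i, M i), IsProbabilityMeasure π' →
        (∀ i, π'.map (fun p => p i) = μ i) →
        ∫ p, c p ∂π ≤ ∫ p, c p ∂π' := by
  have hclosed := isClosed_setOf_forall_map_eval_eq (fun i => (⟨μ i, inferInstance⟩ : ProbabilityMeasure _))
  obtain ⟨π, hπ, hmin⟩ := hclosed.isCompact.exists_isMinOn
    ⟨⟨Measure.pi μ, inferInstance⟩, fun i => (measurePreserving_eval μ i).map_eq⟩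
    (ProbabilityMeasure.continuous_integral_continuousMap (⟨c, hc⟩ : C(∀ i, M i, ℝ))).continuousOn
  exact ⟨π, inferInstance, hπ, fun π' h' hmarg => hmin (a := ⟨π', h'⟩) hmarg⟩
end

section
/- Let M₁,...,Mₘ be compact metric spaces and c : M₁×⋯×Mₘ → ℝ continuous. Suppose v₁,...,vₘ are bounded Borel functions vᵢ : Mᵢ → ℝ satisfying Σᵢ vᵢ(xᵢ) ≤ c(x₁,...,xₘ) for all (x₁,...,xₘ). Then there exists a c-conjugate m-tuple (u₁,...,uₘ) of functions uᵢ : Mᵢ → ℝ such that vᵢ(xᵢ) ≤ uᵢ(xᵢ) for all xᵢ ∈ Mᵢ and all i = 1,...,m. -/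
open MeasureTheory Finset

/-- An `m`-tuple of functions `(u 1, …, u m)` is `c`-conjugate if for every `i`
and every `xi ∈ M i`, `u i xi` is the infimum of
`c (x 1, …, x m) - ∑_{j ≠ i} u j (x j)` over all points whose `i`-th coordinate
is `xi`. -/
def IsCConjugate {m : ℕ} {M : Fin m → Type*} (c : (∀ i, M i) → ℝ)
    (u : ∀ i, M i → ℝ) : Prop :=
  ∀ (i : Fin m) (xi : M i), u i xi =
    sInf {r : ℝ | ∃ x : ∀ j, M j, x i = xi ∧
      r = c x - ∑ j ∈ Finset.univ.erase i, u j (x j)}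

/-- The infimum of `c x - ∑_{j ≠ i} u j (x j)` over all points `x` whose `i`-th coordinate
is `xi`. -/
noncomputable def cTransform {m : ℕ} {M : Fin m → Type*} (c : (∀ i, M i) → ℝ)
    (u : ∀ i, M i → ℝ) (i : Fin m) (xi : M i) : ℝ :=
  sInf {r : ℝ | ∃ x : ∀ j, M j, x i = xi ∧
    r = c x - ∑ j ∈ Finset.univ.erase i, u j (x j)}

section cTransform

variable {m : ℕ} {M : Fin m → Type*} {c : (∀ i, M i) → ℝ} {u w : ∀ i, M i → ℝ}

theorem le_sub_sum_erase_of_sum_le (hu : ∀ x : ∀ i, M i, ∑ i, u i (x i) ≤ c x) (i : Fin m)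
    (x : ∀ j, M j) : u i (x i) ≤ c x - ∑ j ∈ Finset.univ.erase i, u j (x j) := by
  have h := hu x
  rw [← Finset.add_sum_erase _ _ (Finset.mem_univ i)] at h
  linarith

theorem cTransform_le (hu : ∀ x : ∀ i, M i, ∑ i, u i (x i) ≤ c x) (i : Fin m)
    (x : ∀ j, M j) :
    cTransform c u i (x i) ≤ c x - ∑ j ∈ Finset.univ.erase i, u j (x j) := by
  refine csInf_le ⟨u i (x i), ?_⟩ ⟨x, rfl, rfl⟩
  rintro r ⟨y, hy, rfl⟩
  rw [← hy]
  exact le_sub_sum_erase_of_sum_le hu i y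

theorem le_cTransform [∀ i, Nonempty (M i)] {i : Fin m} {xi : M i} {a : ℝ}
    (h : ∀ x : ∀ j, M j, x i = xi → a ≤ c x - ∑ j ∈ Finset.univ.erase i, u j (x j)) :
    a ≤ cTransform c u i xi := by
  refine le_csInf ⟨_, Function.update (fun j => Classical.arbitrary (M j)) i xi,
    Function.update_self .., rfl⟩ ?_
  rintro r ⟨y, hy, rfl⟩
  exact h y hy

theorem self_le_cTransform [∀ i, Nonempty (M i)]
    (hu : ∀ x : ∀ i, M i, ∑ i, u i (x i) ≤ c x) (i : Fin m) (xi : M i) :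
    u i xi ≤ cTransform c u i xi :=
  le_cTransform fun x hx => hx ▸ le_sub_sum_erase_of_sum_le hu i x

theorem cTransform_anti [∀ i, Nonempty (M i)] (hw : ∀ x : ∀ i, M i, ∑ i, w i (x i) ≤ c x)
    (huw : ∀ i xi, u i xi ≤ w i xi) (i : Fin m) (xi : M i) :
    cTransform c w i xi ≤ cTransform c u i xi := by
  refine le_cTransform fun x hx => ?_
  have h := cTransform_le hw i x
  have hsum := Finset.sum_le_sum fun j (_ : j ∈ Finset.univ.erase i) => huw j (x j)
  rw [hx] at h
  linarith

theorem sum_erase_update_eq (i : Fin m) (f : M i → ℝ) (x : ∀ j, M j) :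
    ∑ j ∈ Finset.univ.erase i, Function.update u i f j (x j) =
      ∑ j ∈ Finset.univ.erase i, u j (x j) :=
  Finset.sum_congr rfl fun j hj => by
    rw [Function.update_of_ne (Finset.ne_of_mem_erase hj)]

theorem sum_update_cTransform_le (hu : ∀ x : ∀ i, M i, ∑ i, u i (x i) ≤ c x) (i : Fin m)
    (x : ∀ j, M j) : ∑ j, Function.update u i (cTransform c u i) j (x j) ≤ c x := by
  rw [← Finset.add_sum_erase _ _ (Finset.mem_univ i), sum_erase_update_eq,
    Function.update_self]
  linarith [cTransform_le hu i x]

/-- Every feasible tuple is dominated by a feasible tuple that satisfies the conjugacy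
relation at each index of a given finite set. -/
theorem exists_ge_eq_cTransform_on [∀ i, Nonempty (M i)]
    (hu : ∀ x : ∀ i, M i, ∑ i, u i (x i) ≤ c x) (s : Finset (Fin m)) :
    ∃ w : ∀ i, M i → ℝ, (∀ x : ∀ i, M i, ∑ i, w i (x i) ≤ c x) ∧
      (∀ i xi, u i xi ≤ w i xi) ∧ ∀ i ∈ s, ∀ xi, w i xi = cTransform c w i xi := by
  induction s using Finset.induction_on with
  | empty => exact ⟨u, hu, fun _ _ => le_rfl, by simp⟩
  | insert a s ha ih =>
    obtain ⟨w, hw, huw, hs⟩ := ih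
    have hw' := sum_update_cTransform_le hw a
    have hle : ∀ i xi, w i xi ≤ Function.update w a (cTransform c w a) i xi := by
      intro i xi
      by_cases hi : i = a
      · subst hi
        rw [Function.update_self]
        exact self_le_cTransform hw i xi
      · rw [Function.update_of_ne hi]
    refine ⟨_, hw', fun i xi => (huw i xi).trans (hle i xi), fun i hi xi => ?_⟩
    by_cases hia : i = a
    · subst hia
      rw [Function.update_self]
      simp only [cTransform, sum_erase_update_eq]
    · refine le_antisymm (self_le_cTransform hw' i xi) ?_
      rw [Function.update_of_ne hia, hs i (Finset.mem_of_mem_insert_of_ne hi hia) xi]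
      exact cTransform_anti hw' hle i xi

end cTransform

/-- **Convexification trick.** Any bounded Borel tuple `(v 1, …, v m)` that is
feasible for the dual problem (`∑ i, v i (x i) ≤ c x`) is dominated pointwise by
some `c`-conjugate tuple `(u 1, …, u m)`. -/
theorem exists_cConjugate_ge {m : ℕ} (M : Fin m → Type*) [∀ i, MetricSpace (M i)]
    [∀ i, CompactSpace (M i)] [∀ i, Nonempty (M i)]
    [∀ i, MeasurableSpace (M i)] [∀ i, BorelSpace (M i)]
    (c : (∀ i, M i) → ℝ) (hc : Continuous c)
    (v : ∀ i, M i → ℝ) (hvmeas : ∀ i, Measurable (v i))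
    (hvbdd : ∀ i, ∃ C : ℝ, ∀ x, |v i x| ≤ C)
    (hfeas : ∀ x : ∀ i, M i, ∑ i, v i (x i) ≤ c x) :
    ∃ u : ∀ i, M i → ℝ, IsCConjugate c u ∧ ∀ i xi, v i xi ≤ u i xi := by
  obtain ⟨u, -, hvu, hu⟩ := exists_ge_eq_cTransform_on hfeas Finset.univ
  exact ⟨u, fun i xi => hu i (Finset.mem_univ i) xi, hvu⟩
end

section
/- Let M₁,...,Mₘ be compact metric spaces with Borel probability measures μ₁,...,μₘ and c : M₁×⋯×Mₘ → ℝ continuous. Let μ be any solution of the Kantorovich problem and let (u₁,...,uₘ) be any c-conjugate m-tuple of continuous functions that solves the dual problem (i.e., Σᵢ∫uᵢ dμᵢ equals the minimum of the Kantorovich problem). Then for every point (x₁,...,xₘ) in the support of μ, Σᵢ uᵢ(xᵢ) = c(x₁,...,xₘ). -/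
open MeasureTheory Finset

/-- A `c`-conjugate tuple of continuous functions is feasible for the dual problem. -/
theorem IsCConjugate.sum_le {m : ℕ} {M : Fin m → Type*} [∀ i, TopologicalSpace (M i)]
    [∀ i, CompactSpace (M i)] {c : (∀ i, M i) → ℝ} (hc : Continuous c)
    {u : ∀ i, M i → ℝ} (hu : ∀ i, Continuous (u i)) (h : IsCConjugate c u)
    (i : Fin m) (x : ∀ i, M i) : ∑ j, u j (x j) ≤ c x := by
  have hcont : Continuous fun x : ∀ j, M j => c x - ∑ j ∈ Finset.univ.erase i, u j (x j) := by
    fun_prop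
  have hbdd : BddBelow {r : ℝ | ∃ y : ∀ j, M j, y i = x i ∧
      r = c y - ∑ j ∈ Finset.univ.erase i, u j (y j)} := by
    refine (isCompact_range hcont).bddBelow.mono ?_
    rintro r ⟨y, -, rfl⟩
    exact ⟨y, rfl⟩
  have hle : u i (x i) ≤ c x - ∑ j ∈ Finset.univ.erase i, u j (x j) := by
    rw [h i (x i)]
    exact csInf_le hbdd ⟨x, rfl, rfl⟩
  rw [← Finset.add_sum_erase _ _ (Finset.mem_univ i)]
  linarith

/-- **Complementary slackness.** If `π` solves the Kantorovich problem and
`(u 1, …, u m)` is a `c`-conjugate tuple of continuous functions solving the dual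
problem (its dual value equals the Kantorovich minimum `∫ c dπ`), then
`∑ i, u i (p i) = c p` at every point `p` of the support of `π` (i.e. every
point all of whose open neighbourhoods have positive `π`-measure). -/
theorem eq_on_support {m : ℕ} (M : Fin m → Type*) [∀ i, MetricSpace (M i)]
    [∀ i, CompactSpace (M i)] [∀ i, MeasurableSpace (M i)] [∀ i, BorelSpace (M i)]
    (μ : ∀ i, Measure (M i)) [∀ i, IsProbabilityMeasure (μ i)]
    (c : (∀ i, M i) → ℝ) (hc : Continuous c)
    (π : Measure (∀ i, M i)) (hπ : IsProbabilityMeasure π)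
    (hmarg : ∀ i, π.map (fun p => p i) = μ i)
    (hopt : ∀ π' : Measure (∀ i, M i), IsProbabilityMeasure π' →
      (∀ i, π'.map (fun p => p i) = μ i) →
      ∫ p, c p ∂π ≤ ∫ p, c p ∂π')
    (u : ∀ i, M i → ℝ) (hucont : ∀ i, Continuous (u i))
    (huconj : IsCConjugate c u)
    (hdual : (∑ i, ∫ x, u i x ∂(μ i)) = ∫ p, c p ∂π) :
    ∀ p : ∀ i, M i, (∀ U : Set (∀ i, M i), IsOpen U → p ∈ U → π U ≠ 0) →
      ∑ i, u i (p i) = c p := by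
  intro p hp
  rcases isEmpty_or_nonempty (Fin m) with hm | ⟨⟨i⟩⟩
  · have hconst : c = fun _ => c p := funext fun q => congrArg c (Subsingleton.elim q p)
    rw [hconst] at hdual
    simpa using hdual
  have hint {f : (∀ i, M i) → ℝ} (hf : Continuous f) : Integrable f π :=
    hf.integrable_of_hasCompactSupport (HasCompactSupport.of_compactSpace f)
  have hsum : Continuous fun x : ∀ j, M j => ∑ j, u j (x j) := by fun_prop
  have hzero : ∫ x, (c x - ∑ j, u j (x j)) ∂π = 0 := by
    rw [integral_sub (hint hc) (hint hsum),
      integral_finsetSum (f := fun j (x : ∀ k, M k) => u j (x j)) _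
        fun j _ => hint ((hucont j).comp (continuous_apply j)),
      ← hdual, sub_eq_zero]
    refine Finset.sum_congr rfl fun j _ => ?_
    rw [← hmarg j, integral_map (measurable_pi_apply j).aemeasurable
      (hucont j).aestronglyMeasurable]
  have hae := (integral_eq_zero_iff_of_nonneg
    (fun x => sub_nonneg.2 (huconj.sum_le hc hucont i x)) (hint (hc.sub hsum))).1 hzero
  by_contra hne
  refine hp {x | c x - ∑ j, u j (x j) ≠ 0} (isOpen_ne_fun (hc.sub hsum) continuous_const) ?_ hae
  exact fun h => hne (sub_eq_zero.1 h).symm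
end

section
/- Let M₁,...,Mₘ be bounded convex open subsets of ℝⁿ, let h : ℝⁿ → ℝ be C² with D²h(p) negative definite for every p, and define c(x₁,...,xₘ) = h(x₁ + ⋯ + xₘ). Then for every ȳ = (y₁,...,yₘ) ∈ M₁×⋯×Mₘ and every choice of points ȳ(i) = (y₁(i),...,yₘ(i)) ∈ cl(M₁)×⋯×cl(Mₘ) with yᵢ(i) = yᵢ (i = 2,...,m−1), the tensor T is block diagonal with T⟨v,v⟩ = Σ_{i=2}^{m−1} vᵢᵀ D²h(Σ_{k=1}^{m} y_k(i)) vᵢ for all v = (v₂,...,v_{m−1}) ∈ (ℝⁿ)^{m−2}; in particular T is negative definite. -/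
open MeasureTheory Finset Matrix

/-- The `n × n` matrix of mixed second partial derivatives of `c` in the blocks
`x i` and `x j`. -/
noncomputable def pD2 {m n : ℕ} (c : (Fin m → Fin n → ℝ) → ℝ) (i j : Fin m)
    (x : Fin m → Fin n → ℝ) : Matrix (Fin n) (Fin n) ℝ :=
  Matrix.of fun a b =>
    fderiv ℝ (fun y => fderiv ℝ c y (Pi.single j (Pi.single b 1))) x
      (Pi.single i (Pi.single a 1))

/-- The Hessian matrix of `h : ℝⁿ → ℝ`. -/
noncomputable def hessian {n : ℕ} (h : (Fin n → ℝ) → ℝ) (p : Fin n → ℝ) :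
    Matrix (Fin n) (Fin n) ℝ :=
  Matrix.of fun a b =>
    fderiv ℝ (fun q => fderiv ℝ h q (Pi.single b 1)) p (Pi.single a 1)

/-- The quadratic form `T⟨v,v⟩` of the paper. -/
noncomputable def Ttensor {m n : ℕ} (c : (Fin m → Fin n → ℝ) → ℝ)
    (fst lst : Fin m) (yb : Fin m → Fin n → ℝ) (Y : Fin m → Fin m → Fin n → ℝ)
    (v : Fin m → Fin n → ℝ) : ℝ :=
  -(∑ j ∈ Finset.univ.filter (fun i : Fin m => i ≠ fst ∧ i ≠ lst),
      ∑ i ∈ (Finset.univ.filter (fun i : Fin m => i ≠ fst ∧ i ≠ lst)).erase j,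
        v i ⬝ᵥ (pD2 c i j yb *ᵥ v j))
  + ∑ i ∈ Finset.univ.filter (fun i : Fin m => i ≠ fst ∧ i ≠ lst),
      ∑ j ∈ Finset.univ.filter (fun i : Fin m => i ≠ fst ∧ i ≠ lst),
        v i ⬝ᵥ ((pD2 c i lst yb * (pD2 c fst lst yb)⁻¹ * pD2 c fst j yb) *ᵥ v j)
  + ∑ i ∈ Finset.univ.filter (fun i : Fin m => i ≠ fst ∧ i ≠ lst),
      v i ⬝ᵥ ((pD2 c i i (Y i) - pD2 c i i yb) *ᵥ v i)

/-- The chain rule for a function of the sum of the blocks, in the direction of a single block. -/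
lemma fderiv_comp_sum_single {m n : ℕ} {g : (Fin n → ℝ) → ℝ} (hg : Differentiable ℝ g)
    (x : Fin m → Fin n → ℝ) (i : Fin m) (w : Fin n → ℝ) :
    fderiv ℝ (fun y : Fin m → Fin n → ℝ => g (∑ k, y k)) x (Pi.single i w) =
      fderiv ℝ g (∑ k, x k) w := by
  have hS : HasFDerivAt (fun y : Fin m → Fin n → ℝ => ∑ k, y k)
      (∑ k, ContinuousLinearMap.proj (R := ℝ) (φ := fun _ : Fin m => Fin n → ℝ) k) x :=
    HasFDerivAt.fun_sum fun k _ => hasFDerivAt_apply k x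
  have hcomp := (hg (∑ k, x k)).hasFDerivAt.comp x hS
  have hw : ∑ k, (Pi.single i w : Fin m → Fin n → ℝ) k = w := by simp
  calc _ = fderiv ℝ g (∑ k, x k) (∑ k, (Pi.single i w : Fin m → Fin n → ℝ) k) := by
        rw [show fderiv ℝ (fun y : Fin m → Fin n → ℝ => g (∑ k, y k)) x = _ from hcomp.fderiv,
          ContinuousLinearMap.comp_apply, _root_.sum_apply]
        rfl
    _ = _ := by rw [hw]

/-- Every mixed second derivative of a function of the sum is the Hessian at the sum. -/
lemma pD2_comp_sum {m n : ℕ} {h : (Fin n → ℝ) → ℝ} (hh : ContDiff ℝ 2 h)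
    (i j : Fin m) (x : Fin m → Fin n → ℝ) :
    pD2 (fun y => h (∑ k, y k)) i j x = hessian h (∑ k, x k) := by
  ext a b
  simp only [pD2, hessian, Matrix.of_apply]
  have h1 : Differentiable ℝ h := hh.differentiable (by norm_num)
  have h2 : Differentiable ℝ fun q => fderiv ℝ h q (Pi.single b 1) :=
    ((hh.fderiv_right (m := 1) (by norm_num)).differentiable (by norm_num)).clm_apply
      (differentiable_const _)
  simp only [fderiv_comp_sum_single h1]
  exact fderiv_comp_sum_single h2 x i _

lemma isUnit_det_of_dotProduct_mulVec_neg {n : ℕ} {A : Matrix (Fin n) (Fin n) ℝ}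
    (hA : ∀ v : Fin n → ℝ, v ≠ 0 → v ⬝ᵥ (A *ᵥ v) < 0) : IsUnit A.det := by
  rw [isUnit_iff_ne_zero]
  intro hdet
  obtain ⟨v, hv, hAv⟩ := Matrix.exists_mulVec_eq_zero_iff.mpr hdet
  have := hA v hv
  simp [hAv] at this

/-- **Concave functions of the sum: the tensor `T`.** For the cost
`c (x₁, …, x_m) = h (x₁ + ⋯ + x_m)` with `h` of class `C²` and everywhere
negative definite Hessian, the tensor `T` is block diagonal:
`T⟨v,v⟩ = Σ_{i=2}^{m−1} vᵢᵀ D²h(Σ_k y_k(i)) vᵢ`; in particular `T` is negative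
definite. -/
theorem gangbo_swiech_tensor {m n : ℕ} (hm : 2 ≤ m)
    (M : Fin m → Set (Fin n → ℝ)) (hMo : ∀ i, IsOpen (M i))
    (hMb : ∀ i, Bornology.IsBounded (M i)) (hMconv : ∀ i, Convex ℝ (M i))
    (fst lst : Fin m) (hfst : (fst : ℕ) = 0) (hlst : (lst : ℕ) = m - 1)
    (h : (Fin n → ℝ) → ℝ) (hh : ContDiff ℝ 2 h)
    (hneg : ∀ p v : Fin n → ℝ, v ≠ 0 → v ⬝ᵥ (hessian h p *ᵥ v) < 0)
    (c : (Fin m → Fin n → ℝ) → ℝ) (hcdef : ∀ x, c x = h (∑ i, x i)) :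
    ∀ yb : Fin m → Fin n → ℝ, (∀ k, yb k ∈ M k) →
    ∀ Y : Fin m → Fin m → Fin n → ℝ, (∀ i k, Y i k ∈ closure (M k)) →
    (∀ i, Y i i = yb i) →
    ∀ v : Fin m → Fin n → ℝ, v fst = 0 → v lst = 0 →
      (Ttensor c fst lst yb Y v =
        ∑ i ∈ Finset.univ.filter (fun i : Fin m => i ≠ fst ∧ i ≠ lst),
          v i ⬝ᵥ (hessian h (∑ k, Y i k) *ᵥ v i)) ∧
      (v ≠ 0 → Ttensor c fst lst yb Y v < 0) := by
  intro yb _ Y _ _ v hvf hvl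
  obtain rfl : c = fun x => h (∑ i, x i) := funext hcdef
  have key : Ttensor (fun x => h (∑ i, x i)) fst lst yb Y v =
      ∑ i ∈ Finset.univ.filter (fun i : Fin m => i ≠ fst ∧ i ≠ lst),
        v i ⬝ᵥ (hessian h (∑ k, Y i k) *ᵥ v i) := by
    have hdet := isUnit_det_of_dotProduct_mulVec_neg (hneg (∑ k, yb k))
    simp only [Ttensor, pD2_comp_sum hh, Matrix.mul_nonsing_inv _ hdet, Matrix.one_mul,
      Matrix.sub_mulVec, dotProduct_sub, Finset.sum_sub_distrib]
    rw [Finset.sum_comm (s := Finset.univ.filter (fun i : Fin m => i ≠ fst ∧ i ≠ lst))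
      (t := Finset.univ.filter (fun i : Fin m => i ≠ fst ∧ i ≠ lst))]
    have hsplit := Finset.sum_congr rfl fun j
        (hj : j ∈ Finset.univ.filter (fun i : Fin m => i ≠ fst ∧ i ≠ lst)) =>
      Finset.sum_erase_add _ (fun i => v i ⬝ᵥ (hessian h (∑ k, yb k) *ᵥ v j)) hj
    rw [Finset.sum_add_distrib] at hsplit
    linarith
  refine ⟨key, fun hv => ?_⟩
  rw [key]
  obtain ⟨i, hi⟩ := Function.ne_iff.mp hv
  refine Finset.sum_neg' (fun j _ => ?_) ⟨i, ?_, hneg _ _ hi⟩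
  · rcases eq_or_ne (v j) 0 with hj | hj
    · simp [hj]
    · exact (hneg _ _ hj).le
  · refine Finset.mem_filter.mpr ⟨Finset.mem_univ _, ?_, ?_⟩
    · rintro rfl; exact hi hvf
    · rintro rfl; exact hi hvl
end

section
/- Let M₁, M₃ be bounded open subsets of ℝⁿ, M₂ a bounded convex open subset of ℝⁿ, A an n×n real matrix with vᵀAv < 0 for all v ≠ 0, and define c(x₁,x₂,x₃) = x₁·x₂ + x₁·x₃ + x₂ᵀAx₃. Let μ₁, μ₂, μ₃ be Borel probability measures on M₁, M₂, M₃ with μ₁ vanishing on every set of Hausdorff dimension at most n−1. Then the Kantorovich problem has a unique solution μ, μ is concentrated on the graph {(x₁,G₂(x₁),G₃(x₁)) : x₁ ∈ M₁} of Borel maps Gᵢ : M₁ → Mᵢ, and (G₂,G₃) is the unique (up to μ₁-null sets) solution of the Monge problem. -/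
open MeasureTheory Finset Matrix
open scoped ENNReal

lemma abs_coord_le_of_dotProduct_nonpos {n : ℕ} (i : Fin n) {d w : Fin n → ℝ} {B R : ℝ}
    (hB : 0 < B) (hw : ∀ j, |w j| ≤ R) (hd : 0 ≤ d i) (hwi : B ≤ w i) (h : d ⬝ᵥ w ≤ 0) :
    |d i| ≤ n * R / B * ‖fun j : {j // j ≠ i} => d j‖ := by
  have hR : 0 ≤ R := (abs_nonneg _).trans (hw i)
  have h1 : d i * w i + ∑ j ∈ univ.erase i, d j * w j = d ⬝ᵥ w :=
    Finset.add_sum_erase _ (fun j => d j * w j) (mem_univ i)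
  set D := ‖fun j : {j // j ≠ i} => d j‖ with hD
  have h2 : -(∑ j ∈ univ.erase i, d j * w j) ≤ n * (D * R) := by
    rw [← Finset.sum_neg_distrib]
    calc ∑ j ∈ univ.erase i, -(d j * w j) ≤ ∑ j ∈ univ.erase i, D * R := by
          refine Finset.sum_le_sum fun j hj => ?_
          have hdj : |d j| ≤ D := by
            have := norm_le_pi_norm (fun j : {j // j ≠ i} => d j) ⟨j, Finset.ne_of_mem_erase hj⟩
            simpa using this
          calc -(d j * w j) ≤ |d j * w j| := neg_le_abs _
            _ = |d j| * |w j| := abs_mul _ _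
            _ ≤ D * R := mul_le_mul hdj (hw j) (abs_nonneg _) (norm_nonneg _)
      _ = ((univ.erase i).card : ℝ) * (D * R) := by simp
      _ ≤ n * (D * R) := by
          have : (univ.erase i).card ≤ n := by
            simp
          gcongr
  have h3 : d i * B ≤ d i * w i := by gcongr
  rw [abs_of_nonneg hd, div_mul_eq_mul_div, le_div_iff₀ hB]
  nlinarith

/-- A set on which the coordinate `i` is controlled by the others has dimension `≤ n - 1`. -/
lemma dimH_le_of_abs_coord_le {n : ℕ} (i : Fin n) (S : Set (Fin n → ℝ)) (K : ℝ)
    (h : ∀ x ∈ S, ∀ y ∈ S, |x i - y i| ≤ K * ‖fun j : {j // j ≠ i} => x j - y j‖) :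
    dimH S ≤ ((n - 1 : ℕ) : ℝ≥0∞) := by
  let f : S → ({j // j ≠ i} → ℝ) := fun x j => x.1 j
  have hf : AntilipschitzWith (max 1 K.toNNReal) f := by
    refine AntilipschitzWith.of_le_mul_dist fun x y => ?_
    have hfd : dist (f x) (f y) = ‖fun j : {j // j ≠ i} => x.1 j - y.1 j‖ := dist_eq_norm _ _
    rw [Subtype.dist_eq]
    refine (dist_pi_le_iff (by positivity)).2 fun j => ?_
    by_cases hj : j = i
    · subst hj
      rw [Real.dist_eq, hfd]
      refine (h x x.2 y y.2).trans ?_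
      gcongr
      simp
    · calc dist (x.1 j) (y.1 j) ≤ dist (f x) (f y) := dist_le_pi_dist (f x) (f y) ⟨j, hj⟩
        _ ≤ _ := le_mul_of_one_le_left dist_nonneg (by simp)
  calc dimH S = dimH (Set.univ : Set S) := by
        have := Isometry.dimH_image (f := ((↑) : S → Fin n → ℝ)) isometry_subtype_coe Set.univ
        rwa [Set.image_univ, Subtype.range_coe] at this
    _ ≤ dimH (f '' Set.univ) := hf.le_dimH_image _
    _ ≤ dimH (Set.univ : Set ({j // j ≠ i} → ℝ)) := dimH_mono (Set.subset_univ _)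
    _ = _ := by
        rw [Real.dimH_univ_pi]
        simp [Fintype.card_subtype_compl]

/-- The points where a bounded monotone-decreasing relation on `ℝⁿ` is multivalued form a set of
Hausdorff dimension at most `n - 1`. -/
lemma dimH_multivalued_le {n : ℕ} (Γ : Set ((Fin n → ℝ) × (Fin n → ℝ))) (R : ℝ)
    (hR : ∀ p ∈ Γ, ‖p.2‖ ≤ R)
    (hΓ : ∀ p ∈ Γ, ∀ q ∈ Γ, (p.1 - q.1) ⬝ᵥ (p.2 - q.2) ≤ 0) :
    dimH {x | ∃ y z, (x, y) ∈ Γ ∧ (x, z) ∈ Γ ∧ y ≠ z} ≤ ((n - 1 : ℕ) : ℝ≥0∞) := by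
  let S : Fin n × {r : ℚ × ℚ // r.1 < r.2} → Set (Fin n → ℝ) := fun s =>
    {x | ∃ y z, (x, y) ∈ Γ ∧ (x, z) ∈ Γ ∧ y s.1 ≤ s.2.1.1 ∧ s.2.1.2 ≤ z s.1}
  have hsub : {x | ∃ y z, (x, y) ∈ Γ ∧ (x, z) ∈ Γ ∧ y ≠ z} ⊆ ⋃ s, S s := by
    have key : ∀ x y z, (x, y) ∈ Γ → (x, z) ∈ Γ → ∀ i, y i < z i → x ∈ ⋃ s, S s := by
      intro x y z hy hz i hi
      obtain ⟨a, ha, ha'⟩ := exists_rat_btwn hi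
      obtain ⟨b, hb, hb'⟩ := exists_rat_btwn ha'
      exact Set.mem_iUnion.2 ⟨⟨i, ⟨(a, b), by exact_mod_cast hb⟩⟩, y, z, hy, hz, ha.le, hb'.le⟩
    rintro x ⟨y, z, hy, hz, hyz⟩
    obtain ⟨i, hi⟩ := Function.ne_iff.1 hyz
    rcases lt_or_gt_of_ne hi with hi | hi
    · exact key x y z hy hz i hi
    · exact key x z y hz hy i hi
  refine (dimH_mono hsub).trans ?_
  rw [dimH_iUnion]
  refine iSup_le fun ⟨i, ⟨(a, b), hab⟩⟩ => ?_
  have hab' : (0 : ℝ) < b - a := sub_pos.2 (by exact_mod_cast hab)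
  have key : ∀ x ∈ S ⟨i, ⟨(a, b), hab⟩⟩, ∀ x' ∈ S ⟨i, ⟨(a, b), hab⟩⟩, x' i ≤ x i →
      |x i - x' i| ≤ n * (2 * R) / (b - a) * ‖fun j : {j // j ≠ i} => x j - x' j‖ := by
    rintro x ⟨y, z, hy, hz, hya, hzb⟩ x' ⟨y', z', hy', hz', hya', hzb'⟩ hx
    refine abs_coord_le_of_dotProduct_nonpos i (d := x - x') (w := z - y') hab' ?_ ?_ ?_
      (hΓ _ hz _ hy')
    · intro j
      have h1 := (norm_le_pi_norm z j).trans (hR _ hz)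
      have h2 := (norm_le_pi_norm y' j).trans (hR _ hy')
      have := norm_sub_le (z j) (y' j)
      rw [Real.norm_eq_abs] at this
      simp only [Pi.sub_apply]
      linarith
    · simpa using hx
    · simp only [Pi.sub_apply]
      simp only at hya' hzb
      linarith
  refine dimH_le_of_abs_coord_le i _ (n * (2 * R) / (b - a)) fun x hx x' hx' => ?_
  rcases le_total (x' i) (x i) with h | h
  · exact key x hx x' hx' h
  · have := key x' hx' x hx h
    rw [abs_sub_comm]
    refine this.trans_eq ?_
    congr 1
    rw [← norm_neg]
    congr 1
    ext j
    simp

lemma measurable_finset_piecewise {ι X Ω : Type*} [DecidableEq ι] [MeasurableSpace X]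
    [MeasurableSpace Ω] (s : Finset ι) {f g : Ω → ι → X} (hf : Measurable f) (hg : Measurable g) :
    Measurable fun z => s.piecewise (f z) (g z) := by
  refine measurable_pi_lambda _ fun i => ?_
  by_cases hi : i ∈ s
  · simpa [hi] using measurable_pi_iff.1 hf i
  · simpa [hi] using measurable_pi_iff.1 hg i

/-- Exchanging some coordinates of a pair of independent samples of an optimal plan does not
decrease the total cost, almost surely. -/
lemma ae_swap_le {ι X : Type*} [DecidableEq ι] [MeasurableSpace X]
    (c : (ι → X) → ℝ) (hc : Measurable c) (π : Measure (ι → X)) [IsProbabilityMeasure π]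
    (hcint : ∀ ρ : Measure (ι → X), IsProbabilityMeasure ρ →
      (∀ i, ρ.map (fun p => p i) = π.map (fun p => p i)) → Integrable c ρ)
    (hopt : ∀ ρ : Measure (ι → X), IsProbabilityMeasure ρ →
      (∀ i, ρ.map (fun p => p i) = π.map (fun p => p i)) → ∫ p, c p ∂π ≤ ∫ p, c p ∂ρ)
    (s : Finset ι) :
    ∀ᵐ z ∂(π.prod π), c z.1 + c z.2 ≤ c (s.piecewise z.2 z.1) + c (s.piecewise z.1 z.2) := by
  classical
  set γ := π.prod π with hγ
  have hfst : γ.map Prod.fst = π := by simp [hγ]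
  have hsnd : γ.map Prod.snd = π := by simp [hγ]
  let T₁ : (ι → X) × (ι → X) → ι → X := fun z => s.piecewise z.2 z.1
  let T₂ : (ι → X) × (ι → X) → ι → X := fun z => s.piecewise z.1 z.2
  have hT₁ : Measurable T₁ := measurable_finset_piecewise s measurable_snd measurable_fst
  have hT₂ : Measurable T₂ := measurable_finset_piecewise s measurable_fst measurable_snd
  let W : Set ((ι → X) × (ι → X)) := {z | c (T₁ z) + c (T₂ z) < c z.1 + c z.2}
  have hW : MeasurableSet W := measurableSet_lt
    ((hc.comp hT₁).add (hc.comp hT₂)) ((hc.comp measurable_fst).add (hc.comp measurable_snd))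
  let Φ : (ι → X) × (ι → X) → ι → X := W.piecewise T₁ Prod.fst
  let Ψ : (ι → X) × (ι → X) → ι → X := W.piecewise T₂ Prod.snd
  have hΦ : Measurable Φ := hT₁.piecewise hW measurable_fst
  have hΨ : Measurable Ψ := hT₂.piecewise hW measurable_snd
  let ρ : Measure (ι → X) := (2 : ℝ≥0∞)⁻¹ • (γ.map Φ + γ.map Ψ)
  have hρ : IsProbabilityMeasure ρ := by
    have := Measure.isProbabilityMeasure_map (μ := γ) hΦ.aemeasurable
    have := Measure.isProbabilityMeasure_map (μ := γ) hΨ.aemeasurable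
    constructor
    simp only [ρ, Measure.smul_apply, Measure.add_apply, measure_univ, smul_eq_mul]
    rw [one_add_one_eq_two, ENNReal.inv_mul_cancel (by simp) (by simp)]
  have hmarg : ∀ i, ρ.map (fun p => p i) = π.map (fun p => p i) := by
    intro i
    ext B hB
    have hm : Measurable fun p : ι → X => p i := measurable_pi_apply i
    have hind : Measurable (B.indicator (1 : X → ℝ≥0∞)) := measurable_one.indicator hB
    have hindm : Measurable fun p : ι → X => B.indicator (1 : X → ℝ≥0∞) (p i) := hind.comp hm
    have hΦm : Measurable fun z => B.indicator (1 : X → ℝ≥0∞) (Φ z i) := hindm.comp hΦ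
    have hfstm : Measurable fun z : (ι → X) × (ι → X) => B.indicator (1 : X → ℝ≥0∞) (z.1 i) :=
      hindm.comp measurable_fst
    have hcalc : ∀ F : (ι → X) × (ι → X) → ι → X, Measurable F →
        ((γ.map F).map (fun p => p i)) B = ∫⁻ z, B.indicator 1 (F z i) ∂γ := by
      intro F hF
      rw [← lintegral_indicator_one hB, lintegral_map hind hm, lintegral_map hindm hF]
    have hsum : ((γ.map Φ).map (fun p => p i)) B + ((γ.map Ψ).map (fun p => p i)) B
        = ((γ.map Prod.fst).map (fun p => p i)) B + ((γ.map Prod.snd).map (fun p => p i)) B := by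
      rw [hcalc _ hΦ, hcalc _ hΨ, hcalc _ measurable_fst, hcalc _ measurable_snd,
        ← lintegral_add_left hΦm, ← lintegral_add_left hfstm]
      refine lintegral_congr fun z => ?_
      by_cases hz : z ∈ W
      · by_cases hi : i ∈ s
        · simp [Φ, Ψ, T₁, T₂, hz, hi, add_comm]
        · simp [Φ, Ψ, T₁, T₂, hz, hi]
      · simp [Φ, Ψ, hz]
    rw [hfst, hsnd] at hsum
    simp only [ρ, Measure.map_smul, Measure.map_add _ _ hm, Measure.smul_apply, Measure.add_apply,
      smul_eq_mul]
    rw [hsum, ← two_mul, ← mul_assoc, ENNReal.inv_mul_cancel (by simp) (by simp), one_mul]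
  have hcπ : Integrable c π := hcint π inferInstance fun _ => rfl
  have hcρ : Integrable c (γ.map Φ + γ.map Ψ) := by
    have := hcint ρ hρ hmarg
    rwa [integrable_smul_measure (by simp) (by simp)] at this
  obtain ⟨hcΦ, hcΨ⟩ := integrable_add_measure.1 hcρ
  have hle := hopt ρ hρ hmarg
  have hΦi : Integrable (fun z => c (Φ z)) γ := hcΦ.comp_measurable hΦ
  have hΨi : Integrable (fun z => c (Ψ z)) γ := hcΨ.comp_measurable hΨ
  have h1i : Integrable (fun z => c z.1) γ := (hfst.symm ▸ hcπ :
    Integrable c (γ.map Prod.fst)).comp_measurable measurable_fst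
  have h2i : Integrable (fun z => c z.2) γ := (hsnd.symm ▸ hcπ :
    Integrable c (γ.map Prod.snd)).comp_measurable measurable_snd
  have hρc : ∫ p, c p ∂ρ = 2⁻¹ * (∫ z, c (Φ z) ∂γ + ∫ z, c (Ψ z) ∂γ) := by
    simp only [ρ]
    rw [integral_smul_measure, integral_add_measure hcΦ hcΨ,
      integral_map hΦ.aemeasurable hcΦ.1, integral_map hΨ.aemeasurable hcΨ.1]
    simp
  have hπ1 : ∫ z, c z.1 ∂γ = ∫ p, c p ∂π := by
    conv_rhs => rw [← hfst]
    rw [integral_map measurable_fst.aemeasurable hc.aestronglyMeasurable]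
  have hπ2 : ∫ z, c z.2 ∂γ = ∫ p, c p ∂π := by
    conv_rhs => rw [← hsnd]
    rw [integral_map measurable_snd.aemeasurable hc.aestronglyMeasurable]
  let g : (ι → X) × (ι → X) → ℝ := fun z => (c z.1 + c z.2) - (c (Φ z) + c (Ψ z))
  have hgi : Integrable g γ := (h1i.add h2i).sub (hΦi.add hΨi)
  have hg0 : 0 ≤ g := by
    intro z
    by_cases hz : z ∈ W
    · have : c (T₁ z) + c (T₂ z) < c z.1 + c z.2 := hz
      simp only [Pi.zero_apply, g, Φ, Ψ, Set.piecewise_eq_of_mem _ _ _ hz]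
      linarith
    · simp [g, Φ, Ψ, Set.piecewise_eq_of_notMem _ _ _ hz]
  have hgint : ∫ z, g z ∂γ ≤ 0 := by
    have : ∫ z, g z ∂γ =
        (∫ z, c z.1 ∂γ + ∫ z, c z.2 ∂γ) - (∫ z, c (Φ z) ∂γ + ∫ z, c (Ψ z) ∂γ) := by
      rw [← integral_add h1i h2i, ← integral_add hΦi hΨi]
      exact integral_sub (h1i.add h2i) (hΦi.add hΨi)
    linarith
  have hgae := (integral_eq_zero_iff_of_nonneg hg0 hgi).1
    (le_antisymm hgint (integral_nonneg hg0))
  filter_upwards [hgae] with z hz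
  by_contra hcon
  have hzW : z ∈ W := not_le.1 hcon
  have : c (T₁ z) + c (T₂ z) < c z.1 + c z.2 := hzW
  simp only [g, Φ, Ψ, Set.piecewise_eq_of_mem _ _ _ hzW, Pi.zero_apply] at hz
  linarith

lemma swap_le_of_mem_support {ι X : Type*} [DecidableEq ι] [Countable ι] [MeasurableSpace X]
    [TopologicalSpace X] [SecondCountableTopology X] [BorelSpace X]
    (c : (ι → X) → ℝ) (hc : Continuous c) (π : Measure (ι → X)) [IsProbabilityMeasure π]
    (s : Finset ι)
    (h : ∀ᵐ z ∂(π.prod π), c z.1 + c z.2 ≤ c (s.piecewise z.2 z.1) + c (s.piecewise z.1 z.2))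
    {p q : ι → X} (hp : p ∈ π.support) (hq : q ∈ π.support) :
    c p + c q ≤ c (s.piecewise q p) + c (s.piecewise p q) := by
  by_contra! hcon
  have hpw : ∀ f g : (ι → X) × (ι → X) → ι → X, Continuous f → Continuous g →
      Continuous fun z => s.piecewise (f z) (g z) := by
    intro f g hf hg
    refine continuous_pi fun i => ?_
    by_cases hi : i ∈ s
    · simpa [hi] using continuous_pi_iff.1 hf i
    · simpa [hi] using continuous_pi_iff.1 hg i
  have hopen : IsOpen {z : (ι → X) × (ι → X) |
      c (s.piecewise z.2 z.1) + c (s.piecewise z.1 z.2) < c z.1 + c z.2} :=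
    isOpen_lt ((hc.comp (hpw _ _ continuous_snd continuous_fst)).add
      (hc.comp (hpw _ _ continuous_fst continuous_snd)))
      ((hc.comp continuous_fst).add (hc.comp continuous_snd))
  obtain ⟨U, V, hU, hV, hpU, hqV, hUV⟩ := isOpen_prod_iff.1 hopen p q hcon
  have h0 : (π.prod π) (U ×ˢ V) = 0 := by
    refine measure_mono_null hUV ?_
    simpa [ae_iff] using h
  rw [Measure.prod_prod, mul_eq_zero] at h0
  rcases h0 with h0 | h0
  · exact ((Measure.mem_support_iff_forall p).1 hp U (hU.mem_nhds hpU)).ne' h0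
  · exact ((Measure.mem_support_iff_forall q).1 hq V (hV.mem_nhds hqV)).ne' h0

/-- Existence of an optimal multi-marginal transport plan for compactly supported marginals. -/
lemma exists_optimal_plan {ι X : Type*} [Fintype ι] [MeasurableSpace X] [MetricSpace X]
    [SecondCountableTopology X] [BorelSpace X]
    (c : (ι → X) → ℝ) (hc : Continuous c) (μ : ι → Measure X) [∀ i, IsProbabilityMeasure (μ i)]
    (K : ι → Set X) (hK : ∀ i, IsCompact (K i)) (hμK : ∀ i, ∀ᵐ x ∂(μ i), x ∈ K i) :
    ∃ π : Measure (ι → X), IsProbabilityMeasure π ∧ (∀ i, π.map (fun p => p i) = μ i) ∧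
      ∀ ρ : Measure (ι → X), IsProbabilityMeasure ρ → (∀ i, ρ.map (fun p => p i) = μ i) →
        ∫ p, c p ∂π ≤ ∫ p, c p ∂ρ := by
  have hKc : IsCompact (Set.univ.pi K) := isCompact_univ_pi hK
  obtain ⟨C, hC⟩ := hKc.exists_bound_of_continuousOn hc.continuousOn
  have hsupp : ∀ ρ : Measure (ι → X), (∀ i, ρ.map (fun p => p i) = μ i) →
      ∀ᵐ p ∂ρ, p ∈ Set.univ.pi K := by
    intro ρ hρ
    have : ∀ i, ∀ᵐ p ∂ρ, p i ∈ K i := fun i =>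
      ae_of_ae_map (measurable_pi_apply i).aemeasurable (by rw [hρ i]; exact hμK i)
    filter_upwards [ae_all_iff.2 this] with p hp i _ using hp i
  let b : BoundedContinuousFunction (ι → X) ℝ :=
    BoundedContinuousFunction.ofNormedAddCommGroup (fun p => max (-|C|) (min |C| (c p)))
      (by fun_prop) |C| (fun p => by
        rw [Real.norm_eq_abs, abs_le]
        exact ⟨le_max_left _ _, max_le (by linarith [abs_nonneg C]) (min_le_left _ _)⟩)
  have hbc : ∀ ρ : Measure (ι → X), (∀ i, ρ.map (fun p => p i) = μ i) →
      ∫ p, c p ∂ρ = ∫ p, b p ∂ρ := by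
    intro ρ hρ
    refine integral_congr_ae ?_
    filter_upwards [hsupp ρ hρ] with p hp
    have h := abs_le.1 ((hC p hp).trans (le_abs_self C))
    change c p = max (-|C|) (min |C| (c p))
    rw [min_eq_right h.2, max_eq_right h.1]
  let S : Set (ProbabilityMeasure (ι → X)) :=
    {P | ∀ i, (P : Measure (ι → X)).map (fun p => p i) = μ i}
  have hSclosed : IsClosed S := by
    have : S = ⋂ i, {P : ProbabilityMeasure (ι → X) |
        P.map (f := fun p => p i) (measurable_pi_apply i).aemeasurable = ⟨μ i, inferInstance⟩} := by
      ext P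
      simp only [S, Set.mem_iInter, Set.mem_ofPred_eq]
      refine forall_congr' fun i => ?_
      exact ⟨fun h => Subtype.ext h, fun h => congrArg Subtype.val h⟩
    rw [this]
    exact isClosed_iInter fun i =>
      isClosed_eq (ProbabilityMeasure.continuous_map (continuous_apply i)) continuous_const
  have htight : IsTightMeasureSet
      {((P : ProbabilityMeasure (ι → X)) : Measure (ι → X)) | P ∈ S} := by
    rw [isTightMeasureSet_iff_exists_isCompact_measure_compl_le]
    intro ε _
    refine ⟨_, hKc, ?_⟩
    rintro _ ⟨P, hP, rfl⟩
    have : (P : Measure (ι → X)) (Set.univ.pi K)ᶜ = 0 := hsupp _ hP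
    simp [this]
  have hScomp : IsCompact S := by
    have := isCompact_closure_of_isTightMeasureSet htight
    rwa [hSclosed.closure_eq] at this
  have hne : S.Nonempty :=
    ⟨⟨Measure.pi μ, inferInstance⟩, fun i => (measurePreserving_eval μ i).map_eq⟩
  obtain ⟨P, hPS, hPmin⟩ := hScomp.exists_isMinOn hne
    (ProbabilityMeasure.continuous_integral_boundedContinuousFunction b).continuousOn
  refine ⟨P, inferInstance, hPS, fun ρ hρ hρm => ?_⟩
  rw [hbc _ hPS, hbc _ hρm]
  exact hPmin (show (⟨ρ, hρ⟩ : ProbabilityMeasure (ι → X)) ∈ S from hρm)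

lemma exists_measurable_graph {ι X : Type*} [Countable ι] [MeasurableSpace X] [StandardBorelSpace X]
    [DecidableEq ι] (i₀ : ι) (M : ι → Set X) (hM : ∀ i, MeasurableSet (M i))
    (hne : ∀ i, (M i).Nonempty) (π : Measure (ι → X)) (Γ : Set (ι → X)) (hΓ : MeasurableSet Γ)
    (hΓM : ∀ p ∈ Γ, ∀ i, p i ∈ M i) (hinj : Set.InjOn (fun p => p i₀) Γ) (hπ : ∀ᵐ p ∂π, p ∈ Γ) :
    ∃ F : X → ι → X, Measurable F ∧ (∀ x, F x i₀ = x) ∧ (∀ i, ∀ x ∈ M i₀, F x i ∈ M i) ∧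
      ∀ᵐ p ∂π, F (p i₀) = p := by
  classical
  choose m hm using hne
  have := hΓ.standardBorel
  have hemb : MeasurableEmbedding (fun p : Γ => p.1 i₀) :=
    ((measurable_pi_apply i₀).comp measurable_subtype_coe).measurableEmbedding
      (fun p q h => Subtype.ext (hinj p.2 q.2 h))
  obtain ⟨F', hF', hF'eq⟩ := hemb.exists_measurable_extend
    (measurable_subtype_coe : Measurable fun p : Γ => (p : ι → X)) (fun _ => ⟨m⟩)
  let E : Set X := {x | (∀ i, F' x i ∈ M i) ∧ F' x i₀ = x}
  have hE : MeasurableSet E := by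
    have h1 : MeasurableSet {x | ∀ i, F' x i ∈ M i} := by
      rw [Set.ofPred_forall]
      exact MeasurableSet.iInter fun i => measurable_pi_iff.1 hF' i (hM i)
    exact h1.inter (measurableSet_eq_fun (measurable_pi_iff.1 hF' i₀) measurable_id)
  let G : X → ι → X := fun x => Function.update m i₀ x
  have hG : Measurable G := measurable_update m
  refine ⟨E.piecewise F' G, hF'.piecewise hE hG, fun x => ?_, fun i x hx => ?_, ?_⟩
  · by_cases h : x ∈ E
    · simpa [h] using h.2
    · simp [h, G]
  · by_cases h : x ∈ E
    · simpa [h] using h.1 i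
    · by_cases hi : i = i₀
      · subst hi
        simpa [h, G] using hx
      · simpa [h, G, hi] using hm i
  · filter_upwards [hπ] with p hp
    have hpe : F' (p i₀) = p := congrFun hF'eq ⟨p, hp⟩
    have : p i₀ ∈ E := by
      refine ⟨fun i => ?_, ?_⟩
      · rw [hpe]
        exact hΓM p hp i
      · rw [hpe]
    rw [Set.piecewise_eq_of_mem _ _ _ this, hpe]

/-- Optimal plans for the bilinear cost are concentrated on a graph over the first variable. -/
lemma exists_graph_of_optimal {n : ℕ}
    (M : Fin 3 → Set (Fin n → ℝ)) (hMo : ∀ i, IsOpen (M i))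
    (hMb : ∀ i, Bornology.IsBounded (M i))
    (A : Matrix (Fin n) (Fin n) ℝ)
    (hA : ∀ v : Fin n → ℝ, v ≠ 0 → v ⬝ᵥ (A *ᵥ v) < 0)
    (c : (Fin 3 → Fin n → ℝ) → ℝ) (hc : Continuous c)
    (hcdef : ∀ x : Fin 3 → Fin n → ℝ,
      c x = x 0 ⬝ᵥ x 1 + x 0 ⬝ᵥ x 2 + x 1 ⬝ᵥ (A *ᵥ x 2))
    (π : Measure (Fin 3 → Fin n → ℝ)) [IsProbabilityMeasure π]
    (hπM : ∀ i, ∀ᵐ p ∂π, p i ∈ M i)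
    (hdim : ∀ S : Set (Fin n → ℝ), dimH S ≤ ((n - 1 : ℕ) : ℝ≥0∞) →
      π.map (fun p => p 0) S = 0)
    (hcint : ∀ ρ : Measure (Fin 3 → Fin n → ℝ), IsProbabilityMeasure ρ →
      (∀ i, ρ.map (fun p => p i) = π.map (fun p => p i)) → Integrable c ρ)
    (hopt : ∀ ρ : Measure (Fin 3 → Fin n → ℝ), IsProbabilityMeasure ρ →
      (∀ i, ρ.map (fun p => p i) = π.map (fun p => p i)) → ∫ p, c p ∂π ≤ ∫ p, c p ∂ρ) :
    ∃ F : (Fin n → ℝ) → Fin 3 → Fin n → ℝ, Measurable F ∧ (∀ x, F x 0 = x) ∧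
      (∀ i, ∀ x ∈ M 0, F x i ∈ M i) ∧ ∀ᵐ p ∂π, F (p 0) = p := by
  have hswap : ∀ s : Finset (Fin 3), ∀ p ∈ π.support, ∀ q ∈ π.support,
      c p + c q ≤ c (s.piecewise q p) + c (s.piecewise p q) := fun s p hp q hq =>
    swap_le_of_mem_support c hc π s (ae_swap_le c hc.measurable π hcint hopt s) hp hq
  let Γ₀ : Set (Fin 3 → Fin n → ℝ) := {p | p ∈ π.support ∧ ∀ i, p i ∈ M i}
  have hΓ₀ : MeasurableSet Γ₀ := by
    have hset : MeasurableSet {p : Fin 3 → Fin n → ℝ | ∀ i, p i ∈ M i} := by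
      rw [Set.ofPred_forall]
      exact MeasurableSet.iInter fun i => measurable_pi_apply i (hMo i).measurableSet
    exact Measure.isClosed_support.measurableSet.inter hset
  have hπΓ₀ : ∀ᵐ p ∂π, p ∈ Γ₀ := by
    filter_upwards [Measure.support_mem_ae (μ := π), ae_all_iff.2 hπM] with p h1 h2 using ⟨h1, h2⟩
  have hmono : ∀ p ∈ Γ₀, ∀ q ∈ Γ₀, (p 0 - q 0) ⬝ᵥ ((p 1 + p 2) - (q 1 + q 2)) ≤ 0 := by
    intro p hp q hq
    have h := hswap {0} p hp.1 q hq.1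
    simp only [hcdef] at h
    simp [Finset.piecewise] at h
    simp only [dotProduct_add, dotProduct_sub, sub_dotProduct]
    linarith
  have hinj₀ : ∀ p ∈ Γ₀, ∀ q ∈ Γ₀, p 0 = q 0 → p 1 + p 2 = q 1 + q 2 → p = q := by
    intro p hp q hq h0 h12
    have h := hswap {1} p hp.1 q hq.1
    simp only [hcdef] at h
    simp [Finset.piecewise, h0] at h
    have h2 : p 2 = q 2 - (p 1 - q 1) := by
      rw [eq_sub_iff_add_eq, ← sub_eq_zero]
      rw [← sub_eq_zero] at h12
      rw [← h12]
      abel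
    have h1 : p 1 - q 1 = 0 := by
      by_contra hne
      have := hA _ hne
      rw [h2] at h
      simp only [mulVec_sub, dotProduct_sub, sub_dotProduct] at h this
      linarith
    have h1' : p 1 = q 1 := sub_eq_zero.1 h1
    have h2' : p 2 = q 2 := by rw [h2, h1, sub_zero]
    ext i : 1
    fin_cases i
    · exact h0
    · exact h1'
    · exact h2'
  obtain ⟨R₁, hR₁⟩ := (hMb 1).exists_norm_le
  obtain ⟨R₂, hR₂⟩ := (hMb 2).exists_norm_le
  have hBdim := dimH_multivalued_le ((fun p => (p 0, p 1 + p 2)) '' Γ₀) (R₁ + R₂)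
    (by
      rintro _ ⟨p, hp, rfl⟩
      exact (norm_add_le _ _).trans (add_le_add (hR₁ _ (hp.2 1)) (hR₂ _ (hp.2 2))))
    (by
      rintro _ ⟨p, hp, rfl⟩ _ ⟨q, hq, rfl⟩
      exact hmono p hp q hq)
  set B : Set (Fin n → ℝ) := _
  have hBnull := hdim B hBdim
  set N := toMeasurable (π.map (fun p => p 0)) B with hN
  have hNm : MeasurableSet N := measurableSet_toMeasurable _ _
  have hNnull : ∀ᵐ p ∂π, p 0 ∉ N := by
    refine ae_of_ae_map (f := fun p : Fin 3 → Fin n → ℝ => p 0) (p := fun x => x ∉ N)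
      (measurable_pi_apply 0).aemeasurable ?_
    rw [ae_iff]
    simpa [hN, measure_toMeasurable] using hBnull
  refine exists_measurable_graph 0 M (fun i => (hMo i).measurableSet) (fun i => ?_) π
    (Γ₀ ∩ (fun p => p 0) ⁻¹' Nᶜ) (hΓ₀.inter (measurable_pi_apply 0 hNm.compl)) (fun p hp => hp.1.2) ?_ ?_
  · obtain ⟨p, hp⟩ := (hπM i).exists
    exact ⟨_, hp⟩
  · rintro p ⟨hp, hpN⟩ q ⟨hq, -⟩ h0
    refine hinj₀ p hp q hq h0 ?_
    by_contra hne
    exact hpN (subset_toMeasurable _ _ ⟨p 1 + p 2, q 1 + q 2, ⟨p, hp, rfl⟩,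
      ⟨q, hq, Prod.ext h0.symm rfl⟩, hne⟩)
  · filter_upwards [hπΓ₀, hNnull] with p h1 h2 using ⟨h1, h2⟩

/-- **Bilinear three-marginal costs.** For
`c (x₁,x₂,x₃) = x₁·x₂ + x₁·x₃ + x₂ᵀ A x₃` with `vᵀ A v < 0` for all `v ≠ 0`,
on bounded open `M 0, M 2` and bounded convex open `M 1`, if `μ 1` does not
charge sets of Hausdorff dimension `≤ n − 1`, then the Kantorovich problem has a
unique solution `π`, concentrated on the graph of Borel maps `(G₂, G₃)` over the
first variable, and `(G₂, G₃)` is the unique (up to `μ 1`-null sets) solution of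
the Monge problem. -/
theorem bilinear_cost_monge {n : ℕ}
    (M : Fin 3 → Set (Fin n → ℝ)) (hMo : ∀ i, IsOpen (M i))
    (hMb : ∀ i, Bornology.IsBounded (M i)) (hMconv : Convex ℝ (M 1))
    (A : Matrix (Fin n) (Fin n) ℝ)
    (hA : ∀ v : Fin n → ℝ, v ≠ 0 → v ⬝ᵥ (A *ᵥ v) < 0)
    (c : (Fin 3 → Fin n → ℝ) → ℝ)
    (hcdef : ∀ x : Fin 3 → Fin n → ℝ,
      c x = x 0 ⬝ᵥ x 1 + x 0 ⬝ᵥ x 2 + x 1 ⬝ᵥ (A *ᵥ x 2))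
    (μ : Fin 3 → Measure (Fin n → ℝ)) [∀ i, IsProbabilityMeasure (μ i)]
    (hμM : ∀ i, μ i (M i) = 1)
    (hdim : ∀ S : Set (Fin n → ℝ), dimH S ≤ ((n - 1 : ℕ) : ℝ≥0∞) → μ 0 S = 0) :
    ∃ π : Measure (Fin 3 → Fin n → ℝ), ∃ G : ∀ i : Fin 3, (Fin n → ℝ) → (Fin n → ℝ),
      -- `π` solves the Kantorovich problem …
      IsProbabilityMeasure π ∧ (∀ i, π.map (fun p => p i) = μ i) ∧
      (∀ π' : Measure (Fin 3 → Fin n → ℝ), IsProbabilityMeasure π' →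
        (∀ i, π'.map (fun p => p i) = μ i) → ∫ p, c p ∂π ≤ ∫ p, c p ∂π') ∧
      -- … and is the unique solution
      (∀ π' : Measure (Fin 3 → Fin n → ℝ), IsProbabilityMeasure π' →
        (∀ i, π'.map (fun p => p i) = μ i) →
        (∀ π'' : Measure (Fin 3 → Fin n → ℝ), IsProbabilityMeasure π'' →
          (∀ i, π''.map (fun p => p i) = μ i) → ∫ p, c p ∂π' ≤ ∫ p, c p ∂π'') →
        π' = π) ∧
      -- `π` is concentrated on the graph of the Borel maps `(G₂, G₃)`
      (∀ i, Measurable (G i)) ∧ G 0 = id ∧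
      (∀ i, ∀ x ∈ M 0, G i x ∈ M i) ∧
      π {p | ∃ x₁ ∈ M 0, p = fun i => G i x₁} = 1 ∧
      (∀ i, (μ 0).map (G i) = μ i) ∧
      -- `(G₂, G₃)` solves the Monge problem …
      (∀ H : ∀ i : Fin 3, (Fin n → ℝ) → (Fin n → ℝ), (∀ i, Measurable (H i)) →
        H 0 = id → (∀ i, (μ 0).map (H i) = μ i) →
        ∫ x, c (fun i => G i x) ∂(μ 0) ≤ ∫ x, c (fun i => H i x) ∂(μ 0)) ∧
      -- … and is the unique solution up to `μ 1`-null sets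
      (∀ H : ∀ i : Fin 3, (Fin n → ℝ) → (Fin n → ℝ), (∀ i, Measurable (H i)) →
        H 0 = id → (∀ i, (μ 0).map (H i) = μ i) →
        (∀ H' : ∀ i : Fin 3, (Fin n → ℝ) → (Fin n → ℝ), (∀ i, Measurable (H' i)) →
          H' 0 = id → (∀ i, (μ 0).map (H' i) = μ i) →
          ∫ x, c (fun i => H i x) ∂(μ 0) ≤ ∫ x, c (fun i => H' i x) ∂(μ 0)) →
        ∀ᵐ x ∂(μ 0), ∀ i, H i x = G i x) := by
  have hM : ∀ i, MeasurableSet (M i) := fun i => (hMo i).measurableSet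
  have hμM' : ∀ i, ∀ᵐ x ∂(μ i), x ∈ M i := fun i => (prob_compl_eq_zero_iff (hM i)).2 (hμM i)
  have hK : ∀ i, IsCompact (closure (M i)) := fun i => (hMb i).isCompact_closure
  have hc : Continuous c := by
    have : c = fun x => x 0 ⬝ᵥ x 1 + x 0 ⬝ᵥ x 2 + x 1 ⬝ᵥ (A *ᵥ x 2) := funext hcdef
    rw [this]
    fun_prop
  have hmem : ∀ ρ : Measure (Fin 3 → Fin n → ℝ), (∀ i, ρ.map (fun p => p i) = μ i) →
      ∀ i, ∀ᵐ p ∂ρ, p i ∈ M i := fun ρ hρ i =>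
    ae_of_ae_map (measurable_pi_apply i).aemeasurable (by rw [hρ i]; exact hμM' i)
  have hcint : ∀ ρ : Measure (Fin 3 → Fin n → ℝ), IsProbabilityMeasure ρ →
      (∀ i, ρ.map (fun p => p i) = μ i) → Integrable c ρ := by
    intro ρ _ hρ
    obtain ⟨C, hC⟩ := (isCompact_univ_pi hK).exists_bound_of_continuousOn hc.continuousOn
    refine Integrable.of_bound hc.aestronglyMeasurable C ?_
    filter_upwards [ae_all_iff.2 (hmem ρ hρ)] with p hp
    exact hC p fun i _ => subset_closure (hp i)
  have hgraph : ∀ ρ : Measure (Fin 3 → Fin n → ℝ), IsProbabilityMeasure ρ →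
      (∀ i, ρ.map (fun p => p i) = μ i) →
      (∀ ρ' : Measure (Fin 3 → Fin n → ℝ), IsProbabilityMeasure ρ' →
        (∀ i, ρ'.map (fun p => p i) = μ i) → ∫ p, c p ∂ρ ≤ ∫ p, c p ∂ρ') →
      ∃ F : (Fin n → ℝ) → Fin 3 → Fin n → ℝ, Measurable F ∧ (∀ x, F x 0 = x) ∧
        (∀ i, ∀ x ∈ M 0, F x i ∈ M i) ∧ ∀ᵐ p ∂ρ, F (p 0) = p := by
    intro ρ _ hρ hρopt
    refine exists_graph_of_optimal M hMo hMb A hA c hc hcdef ρ (hmem ρ hρ) ?_ ?_ ?_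
    · rw [hρ 0]
      exact hdim
    · simpa only [hρ] using hcint
    · simpa only [hρ] using hρopt
  have hmapF : ∀ (ρ : Measure (Fin 3 → Fin n → ℝ)) (F : (Fin n → ℝ) → Fin 3 → Fin n → ℝ),
      (∀ i, ρ.map (fun p => p i) = μ i) → Measurable F → (∀ᵐ p ∂ρ, F (p 0) = p) →
      ρ = (μ 0).map F := by
    intro ρ F hρ hF hFρ
    rw [← hρ 0, Measure.map_map hF (measurable_pi_apply 0)]
    conv_lhs => rw [← Measure.map_id (μ := ρ)]
    refine Measure.map_congr ?_
    filter_upwards [hFρ] with p hp using hp.symm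
  obtain ⟨π, hπ, hπm, hπopt⟩ := exists_optimal_plan c hc μ (fun i => closure (M i)) hK
    fun i => (hμM' i).mono fun _ hx => subset_closure hx
  have huniq : ∀ π' : Measure (Fin 3 → Fin n → ℝ), IsProbabilityMeasure π' →
      (∀ i, π'.map (fun p => p i) = μ i) →
      (∀ π'' : Measure (Fin 3 → Fin n → ℝ), IsProbabilityMeasure π'' →
        (∀ i, π''.map (fun p => p i) = μ i) → ∫ p, c p ∂π' ≤ ∫ p, c p ∂π'') → π' = π := by
    intro π' hπ' hπ'm hπ'opt
    let ρ : Measure (Fin 3 → Fin n → ℝ) := (2 : ℝ≥0∞)⁻¹ • (π' + π)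
    have h2 : (2 : ℝ≥0∞)⁻¹ * 2 = 1 := ENNReal.inv_mul_cancel (by simp) (by simp)
    have hρ : IsProbabilityMeasure ρ := by
      constructor
      simp [ρ, ENNReal.inv_two_add_inv_two]
    have hρm : ∀ i, ρ.map (fun p => p i) = μ i := by
      intro i
      simp only [ρ, Measure.map_smul, Measure.map_add _ _ (measurable_pi_apply i), hπm, hπ'm]
      rw [← two_smul ℝ≥0∞ (μ i), smul_smul, h2, one_smul]
    have hρopt : ∀ π'' : Measure (Fin 3 → Fin n → ℝ), IsProbabilityMeasure π'' →
        (∀ i, π''.map (fun p => p i) = μ i) → ∫ p, c p ∂ρ ≤ ∫ p, c p ∂π'' := by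
      intro π'' hπ'' hπ''m
      have h1 := hπopt π'' hπ'' hπ''m
      have h1' := hπ'opt π'' hπ'' hπ''m
      simp only [ρ]
      rw [integral_smul_measure, integral_add_measure (hcint π' hπ' hπ'm) (hcint π hπ hπm)]
      simp only [ENNReal.toReal_inv, ENNReal.toReal_ofNat, smul_eq_mul]
      linarith
    obtain ⟨F, hF, -, -, hFρ⟩ := hgraph ρ hρ hρm hρopt
    have hFadd : ∀ᵐ p ∂(π' + π), F (p 0) = p := by
      rwa [Measure.ae_ennreal_smul_measure_iff (by simp)] at hFρ
    rw [ae_add_measure_iff] at hFadd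
    rw [hmapF π' F hπ'm hF hFadd.1, ← hmapF π F hπm hF hFadd.2]
  obtain ⟨F, hF, hF0, hFM, hFπ⟩ := hgraph π hπ hπm hπopt
  have hπF := hmapF π F hπm hF hFπ
  have hFi : ∀ i, Measurable fun x => F x i := fun i => measurable_pi_iff.1 hF i
  have hplan : ∀ H : ∀ i : Fin 3, (Fin n → ℝ) → (Fin n → ℝ), (∀ i, Measurable (H i)) →
      (∀ i, (μ 0).map (H i) = μ i) →
      IsProbabilityMeasure ((μ 0).map fun x i => H i x) ∧
      (∀ i, ((μ 0).map fun x i => H i x).map (fun p => p i) = μ i) ∧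
      ∫ p, c p ∂((μ 0).map fun x i => H i x) = ∫ x, c (fun i => H i x) ∂(μ 0) := by
    intro H hH hHm
    have hHm' : Measurable fun x i => H i x := measurable_pi_iff.2 hH
    refine ⟨Measure.isProbabilityMeasure_map hHm'.aemeasurable, fun i => ?_,
      integral_map hHm'.aemeasurable hc.aestronglyMeasurable⟩
    rw [Measure.map_map (measurable_pi_apply i) hHm', ← hHm i]
    rfl
  have hFm : ∀ i, (μ 0).map (fun x => F x i) = μ i := by
    intro i
    rw [← hπm i, hπF, Measure.map_map (measurable_pi_apply i) hF]
    rfl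
  have hcost : ∫ x, c (fun i => F x i) ∂(μ 0) = ∫ p, c p ∂π := by
    rw [hπF, integral_map hF.aemeasurable hc.aestronglyMeasurable]
  refine ⟨π, fun i x => F x i, hπ, hπm, hπopt, huniq, hFi, funext hF0, hFM, ?_, hFm, ?_, ?_⟩
  · rw [← measure_univ (μ := π)]
    refine measure_congr (Filter.eventuallyEq_univ.2 ?_)
    filter_upwards [hFπ, hmem π hπm 0] with p hp hp0 using ⟨p 0, hp0, hp.symm⟩
  · intro H hH _ hHm
    obtain ⟨h1, h2, h3⟩ := hplan H hH hHm
    rw [hcost, ← h3]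
    exact hπopt _ h1 h2
  · intro H hH hH0 hHm hHopt
    obtain ⟨h1, h2, h3⟩ := hplan H hH hHm
    have hle := hHopt (fun i x => F x i) hFi (funext hF0) hFm
    have hHπ : (μ 0).map (fun x i => H i x) = π := huniq _ h1 h2 fun π'' h h' => by
      rw [h3]
      exact (hle.trans_eq hcost).trans (hπopt π'' h h')
    have hHF : ∀ᵐ x ∂(μ 0), F (H 0 x) = fun i => H i x :=
      ae_of_ae_map (measurable_pi_iff.2 hH).aemeasurable (by rw [hHπ]; exact hFπ)
    filter_upwards [hHF] with x hx i
    have := congrFun hx i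
    rw [hH0] at this
    exact this.symm
end

section
/- Let A be an n×n real matrix and define c : (ℝⁿ)³ → ℝ by c(x₁,x₂,x₃) = x₁·x₂ + x₁·x₃ + x₂ᵀAx₃. Then c is equivalent to the Gangbo–Świȩch cost −x₁·x₂ − x₁·x₃ − x₂·x₃ up to invertible linear changes of coordinates — i.e., there exist invertible linear maps U₁,U₂,U₃ : ℝⁿ → ℝⁿ and functions g₁,g₂,g₃ : ℝⁿ → ℝ such that c(U₁x₁, U₂x₂, U₃x₃) = −x₁·x₂ − x₁·x₃ − x₂·x₃ + g₁(x₁) + g₂(x₂) + g₃(x₃) for all x₁,x₂,x₃ — if and only if A is symmetric and negative definite. -/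
open Matrix

open scoped MatrixOrder in
theorem Matrix.PosDef.exists_isUnit_eq_transpose_mul_self {ι : Type*} [Fintype ι] [DecidableEq ι]
    {M : Matrix ι ι ℝ} (hM : M.PosDef) : ∃ B : Matrix ι ι ℝ, IsUnit B ∧ M = Bᵀ * B := by
  obtain ⟨B, hB, h⟩ := CStarAlgebra.isStrictlyPositive_iff_eq_star_mul_self.mp hM.isStrictlyPositive
  exact ⟨B, hB, by rw [h, star_eq_conjTranspose, conjTranspose_eq_transpose_of_trivial]⟩

/-- Functions of the single variables cannot change the mixed terms of a cost, provided that these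
vanish as soon as one of their arguments does. -/
theorem mixed_terms_eq_of_equivalent {α β γ : Type*} [Zero α] [Zero β] [Zero γ]
    {b₁₂ : α → β → ℝ} {b₁₃ : α → γ → ℝ} {b₂₃ : β → γ → ℝ} {g₁ : α → ℝ} {g₂ : β → ℝ} {g₃ : γ → ℝ}
    (h₁₂ : ∀ x y, x = 0 ∨ y = 0 → b₁₂ x y = 0) (h₁₃ : ∀ x y, x = 0 ∨ y = 0 → b₁₃ x y = 0)
    (h₂₃ : ∀ x y, x = 0 ∨ y = 0 → b₂₃ x y = 0)
    (h : ∀ x y z, b₁₂ x y + b₁₃ x z + b₂₃ y z = g₁ x + g₂ y + g₃ z) :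
    (∀ x y, b₁₂ x y = 0) ∧ (∀ x z, b₁₃ x z = 0) ∧ ∀ y z, b₂₃ y z = 0 := by
  have e₁ x : g₁ x + g₂ 0 + g₃ 0 = 0 := by simp [← h, h₁₂, h₁₃, h₂₃]
  have e₂ y : g₁ 0 + g₂ y + g₃ 0 = 0 := by simp [← h, h₁₂, h₁₃, h₂₃]
  have e₃ z : g₁ 0 + g₂ 0 + g₃ z = 0 := by simp [← h, h₁₂, h₁₃, h₂₃]
  refine ⟨fun x y => ?_, fun x z => ?_, fun y z => ?_⟩
  · have := h x y 0
    rw [h₁₃ x 0 (.inr rfl), h₂₃ y 0 (.inr rfl)] at this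
    linarith [e₁ x, e₂ y, e₁ 0]
  · have := h x 0 z
    rw [h₁₂ x 0 (.inr rfl), h₂₃ 0 z (.inl rfl)] at this
    linarith [e₁ x, e₃ z, e₁ 0]
  · have := h 0 y z
    rw [h₁₂ 0 y (.inl rfl), h₁₃ 0 z (.inl rfl)] at this
    linarith [e₂ y, e₃ z, e₁ 0]

/-- **Equivalence with the Gangbo–Świȩch cost.** The bilinear cost
`c (x₁,x₂,x₃) = x₁·x₂ + x₁·x₃ + x₂ᵀ A x₃` is equivalent, after invertible linear
changes of coordinates in each variable, to the Gangbo–Świȩch cost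
`−x₁·x₂ − x₁·x₃ − x₂·x₃` (up to additive functions of the single variables) if
and only if `A` is symmetric and negative definite. -/
theorem bilinear_equiv_gangbo_swiech {n : ℕ} (A : Matrix (Fin n) (Fin n) ℝ) :
    (∃ U₁ U₂ U₃ : Matrix (Fin n) (Fin n) ℝ, IsUnit U₁ ∧ IsUnit U₂ ∧ IsUnit U₃ ∧
      ∃ g₁ g₂ g₃ : (Fin n → ℝ) → ℝ, ∀ x₁ x₂ x₃ : Fin n → ℝ,
        (U₁ *ᵥ x₁) ⬝ᵥ (U₂ *ᵥ x₂) + (U₁ *ᵥ x₁) ⬝ᵥ (U₃ *ᵥ x₃)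
            + (U₂ *ᵥ x₂) ⬝ᵥ (A *ᵥ (U₃ *ᵥ x₃)) =
          -(x₁ ⬝ᵥ x₂) - x₁ ⬝ᵥ x₃ - x₂ ⬝ᵥ x₃ + g₁ x₁ + g₂ x₂ + g₃ x₃) ↔
    (A.IsSymm ∧ ∀ v : Fin n → ℝ, v ≠ 0 → v ⬝ᵥ (A *ᵥ v) < 0) := by
  constructor
  · rintro ⟨U₁, U₂, U₃, hU₁, hU₂, -, g₁, g₂, g₃, h⟩
    obtain ⟨h₁₂, h₁₃, h₂₃⟩ := mixed_terms_eq_of_equivalent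
      (b₁₂ := fun x y => (U₁ *ᵥ x) ⬝ᵥ (U₂ *ᵥ y) + x ⬝ᵥ y)
      (b₁₃ := fun x y => (U₁ *ᵥ x) ⬝ᵥ (U₃ *ᵥ y) + x ⬝ᵥ y)
      (b₂₃ := fun x y => (U₂ *ᵥ x) ⬝ᵥ (A *ᵥ (U₃ *ᵥ y)) + x ⬝ᵥ y)
      (g₁ := g₁) (g₂ := g₂) (g₃ := g₃)
      (by rintro x y (rfl | rfl) <;> simp) (by rintro x y (rfl | rfl) <;> simp)
      (by rintro x y (rfl | rfl) <;> simp) (fun x y z => by linarith [h x y z])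
    have hU₂₃ (y) : U₃ *ᵥ y = U₂ *ᵥ y := by
      refine dotProduct_eq _ _ fun u => ?_
      obtain ⟨x, rfl⟩ := mulVec_surjective_iff_isUnit.2 hU₁ u
      rw [dotProduct_comm _ (U₁ *ᵥ x), dotProduct_comm _ (U₁ *ᵥ x)]
      linarith [h₁₂ x y, h₁₃ x y]
    have hA (x y) : (U₂ *ᵥ x) ⬝ᵥ (A *ᵥ (U₂ *ᵥ y)) = -(x ⬝ᵥ y) := by
      rw [← hU₂₃ y]
      linarith [h₂₃ x y]
    have hsurj := mulVec_surjective_iff_isUnit.2 hU₂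
    constructor
    · refine ext_iff_mulVec.2 fun v => dotProduct_eq _ _ fun u => ?_
      obtain ⟨x, rfl⟩ := hsurj v
      obtain ⟨y, rfl⟩ := hsurj u
      rw [dotProduct_comm, dotProduct_transpose_mulVec, hA, dotProduct_comm (A *ᵥ _), hA,
        dotProduct_comm]
    · intro v hv
      obtain ⟨x, rfl⟩ := hsurj v
      have hx : x ≠ 0 := by
        rintro rfl
        simp at hv
      rw [hA, neg_lt_zero]
      simpa using dotProduct_star_self_pos_iff.2 hx
  · rintro ⟨hsymm, hneg⟩
    have hpos : (-A).PosDef := by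
      refine .of_dotProduct_mulVec_pos ?_ fun x hx => ?_
      · rw [IsHermitian, conjTranspose_eq_transpose_of_trivial, transpose_neg, hsymm.eq]
      · simpa [neg_mulVec] using hneg x hx
    obtain ⟨B, hB, hAB⟩ := hpos.exists_isUnit_eq_transpose_mul_self
    have hdet := (isUnit_iff_isUnit_det B).1 hB
    have hBinv (x) : B *ᵥ (B⁻¹ *ᵥ x) = x := by
      rw [mulVec_mulVec, mul_nonsing_inv _ hdet, one_mulVec]
    have hBinv' : IsUnit B⁻¹ := isUnit_nonsing_inv_iff.2 hB
    have hcross (x y) : (-Bᵀ *ᵥ x) ⬝ᵥ (B⁻¹ *ᵥ y) = -(x ⬝ᵥ y) := by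
      rw [neg_mulVec, neg_dotProduct, dotProduct_comm, dotProduct_transpose_mulVec, hBinv]
    refine ⟨-Bᵀ, B⁻¹, B⁻¹, ((isUnit_transpose B).2 hB).neg, hBinv', hBinv', 0, 0, 0,
      fun x y z => ?_⟩
    have hquad : (B⁻¹ *ᵥ y) ⬝ᵥ (A *ᵥ (B⁻¹ *ᵥ z)) = -(y ⬝ᵥ z) := by
      rw [← neg_neg A, hAB, neg_mulVec, dotProduct_neg, ← mulVec_mulVec, hBinv,
        dotProduct_transpose_mulVec, hBinv, dotProduct_comm]
    rw [hcross, hcross, hquad]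
    simp only [Pi.zero_apply]
    ring
end

section
/- Let M₁,...,Mₘ be bounded open subsets of ℝⁿ and Z a bounded open subset of ℝⁿ; let each f_k : cl(M_k) × cl(Z) → ℝ be C², and suppose that for every x ∈ M₁×⋯×Mₘ the function z ↦ Σ_k f_k(x_k,z) attains its infimum over cl(Z) at a unique point z(x) ∈ Z with A(x) = Σ_k D²_{zz}f_k(x_k, z(x)) invertible. Define c(x₁,...,xₘ) = inf_{z∈cl(Z)} Σ_k f_k(x_k,z). Fix i ≠ j and assume: the map z ↦ D_{xᵢ}fᵢ(xᵢ,z) is injective for each fixed xᵢ, and the map xⱼ ↦ D_z fⱼ(xⱼ,z) is injective for each fixed z. Then c is (i,j)-twisted. -/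
open MeasureTheory Finset Matrix

/-- The partial gradient of `c` with respect to its `i`-th block of variables. -/
noncomputable def pgrad {m n : ℕ} (c : (Fin m → Fin n → ℝ) → ℝ) (i : Fin m)
    (x : Fin m → Fin n → ℝ) : Fin n → ℝ :=
  fun a => fderiv ℝ c x (Pi.single i (Pi.single a 1))

/-- The gradient of `f (y, z)` in the first variable `y` at `(xi, z)`. -/
noncomputable def gradX {n : ℕ} (f : (Fin n → ℝ) → (Fin n → ℝ) → ℝ)
    (xi z : Fin n → ℝ) : Fin n → ℝ :=
  fun a => fderiv ℝ (fun y => f y z) xi (Pi.single a 1)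

/-- The gradient of `f (y, z)` in the second variable `z` at `(xi, z)`. -/
noncomputable def gradZ {n : ℕ} (f : (Fin n → ℝ) → (Fin n → ℝ) → ℝ)
    (xi z : Fin n → ℝ) : Fin n → ℝ :=
  fun a => fderiv ℝ (fun w => f xi w) z (Pi.single a 1)

/-- The Hessian matrix of `f (xi, z)` in the variable `z`. -/
noncomputable def D2zz {n : ℕ} (f : (Fin n → ℝ) → (Fin n → ℝ) → ℝ)
    (xi z : Fin n → ℝ) : Matrix (Fin n) (Fin n) ℝ :=
  Matrix.of fun a b =>
    fderiv ℝ (fun w => fderiv ℝ (fun w' => f xi w') w (Pi.single b 1)) z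
      (Pi.single a 1)

open Filter Topology

/-- **Envelope theorem.** If `ζ` is continuous at `x`, minimizes `F (x', ·)` among the relevant
competitors for `x'` near `x`, and `F` is strictly differentiable at `(x, ζ x)`, then the value
function is differentiable at `x`, with the partial derivative of `F` as its derivative. -/
theorem hasFDerivAt_of_envelope {E V : Type*} [NormedAddCommGroup E] [NormedSpace ℝ E]
    [NormedAddCommGroup V] [NormedSpace ℝ V] {F : E × V → ℝ} {F' : E × V →L[ℝ] ℝ}
    {c : E → ℝ} {ζ : E → V} {x : E} (hF : HasStrictFDerivAt F F' (x, ζ x))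
    (hζ : ContinuousAt ζ x) (hc : ∀ᶠ x' in 𝓝 x, c x' = F (x', ζ x'))
    (hle : ∀ᶠ x' in 𝓝 x, F (x', ζ x') ≤ F (x', ζ x))
    (hge : ∀ᶠ x' in 𝓝 x, F (x, ζ x) ≤ F (x, ζ x')) :
    HasFDerivAt c (F'.comp (ContinuousLinearMap.inl ℝ E V)) x := by
  have key : ∀ g : E → V, Tendsto g (𝓝 x) (𝓝 (ζ x)) → ∀ ε > 0, ∀ᶠ x' in 𝓝 x,
      ‖F (x', g x') - F (x, g x') - F' (x' - x, 0)‖ ≤ ε * ‖x' - x‖ := by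
    intro g hg ε hε
    have ht : Tendsto (fun x' => ((x', g x'), (x, g x'))) (𝓝 x) (𝓝 ((x, ζ x), (x, ζ x))) :=
      (tendsto_id.prodMk_nhds hg).prodMk_nhds (tendsto_const_nhds.prodMk_nhds hg)
    filter_upwards [ht.eventually (hF.isLittleO.def hε)] with x' h
    simpa [Prod.norm_def] using h
  rw [hasFDerivAt_iff_isLittleO, Asymptotics.isLittleO_iff]
  intro ε hε
  filter_upwards [key ζ hζ ε hε, key (fun _ => ζ x) tendsto_const_nhds ε hε, hc, hle, hge]
    with x' h1 h2 h3 h4 h5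
  rw [Real.norm_eq_abs, abs_le] at h1 h2 ⊢
  rw [h3, hc.self_of_nhds]
  simp only [ContinuousLinearMap.comp_apply, ContinuousLinearMap.inl_apply]
  constructor <;> linarith [h1.1, h2.2]

/-- Unique minimizers over a compact set depend continuously on the parameter. -/
theorem continuousAt_of_unique_min {E V : Type*} [TopologicalSpace E] [TopologicalSpace V]
    {F : E × V → ℝ} {K : Set V} (hK : IsCompact K) {ζ : E → V} {x : E}
    (hF : ∀ w ∈ K, ContinuousAt F (x, w)) (hζK : ∀ᶠ x' in 𝓝 x, ζ x' ∈ K)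
    (hmin : ∀ᶠ x' in 𝓝 x, F (x', ζ x') ≤ F (x', ζ x))
    (huniq : ∀ w ∈ K, F (x, w) ≤ F (x, ζ x) → w = ζ x) : ContinuousAt ζ x := by
  refine hK.le_nhds_of_unique_clusterPt hζK fun w hw hcl => ?_
  obtain ⟨U, hU, hUw⟩ := mapClusterPt_iff_ultrafilter.1 hcl
  refine huniq w hw (le_of_tendsto_of_tendsto
    ((hF w hw).tendsto.comp ((tendsto_id.mono_left hU).prodMk_nhds hUw))
    ((hF (ζ x) hζK.self_of_nhds).tendsto.comp
      ((tendsto_id.mono_left hU).prodMk_nhds tendsto_const_nhds)) ?_)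
  exact hmin.filter_mono hU

/-- **Twistedness of the hedonic-pricing cost.** For
`c x = inf_{z ∈ cl Z} Σ_k f k (x k) z`, if `z ↦ D_{x i} f i (xi, z)` is injective
for each fixed `xi` and `xj ↦ D_z f j (xj, z)` is injective for each fixed `z`,
then `c` is `(i,j)`-twisted. -/
theorem hedonic_twist {m n : ℕ}
    (M : Fin m → Set (Fin n → ℝ)) (hMo : ∀ i, IsOpen (M i))
    (hMb : ∀ i, Bornology.IsBounded (M i))
    (Z : Set (Fin n → ℝ)) (hZo : IsOpen Z) (hZb : Bornology.IsBounded Z)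
    (f : Fin m → (Fin n → ℝ) → (Fin n → ℝ) → ℝ)
    (hf : ∀ k, ∃ U : Set ((Fin n → ℝ) × (Fin n → ℝ)), IsOpen U ∧
      closure (M k) ×ˢ closure Z ⊆ U ∧
      ContDiffOn ℝ 2 (fun p : (Fin n → ℝ) × (Fin n → ℝ) => f k p.1 p.2) U)
    (zmin : (Fin m → Fin n → ℝ) → Fin n → ℝ)
    (hzZ : ∀ x : Fin m → Fin n → ℝ, (∀ k, x k ∈ M k) → zmin x ∈ Z)
    (hzmin : ∀ x : Fin m → Fin n → ℝ, (∀ k, x k ∈ M k) → ∀ w ∈ closure Z,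
      ∑ k, f k (x k) (zmin x) ≤ ∑ k, f k (x k) w)
    (hzuniq : ∀ x : Fin m → Fin n → ℝ, (∀ k, x k ∈ M k) → ∀ w ∈ closure Z,
      ∑ k, f k (x k) w = ∑ k, f k (x k) (zmin x) → w = zmin x)
    (hA : ∀ x : Fin m → Fin n → ℝ, (∀ k, x k ∈ M k) →
      IsUnit (∑ k, D2zz (f k) (x k) (zmin x)))
    (c : (Fin m → Fin n → ℝ) → ℝ)
    (hcdef : ∀ x, c x = sInf {r : ℝ | ∃ w ∈ closure Z, r = ∑ k, f k (x k) w})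
    (i j : Fin m) (hij : i ≠ j)
    -- `f i` is `(x i, z)`-twisted
    (hfi : ∀ xi ∈ M i, ∀ z ∈ Z, ∀ z' ∈ Z,
      gradX (f i) xi z = gradX (f i) xi z' → z = z')
    -- `f j` is `(z, x j)`-twisted
    (hfj : ∀ z ∈ Z, ∀ xj ∈ M j, ∀ xj' ∈ M j,
      gradZ (f j) xj z = gradZ (f j) xj' z → xj = xj') :
    -- `c` is `(i,j)`-twisted
    ∀ x : Fin m → Fin n → ℝ, (∀ k, x k ∈ M k) → ∀ y ∈ M j, ∀ y' ∈ M j,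
      pgrad c i (Function.update x j y) = pgrad c i (Function.update x j y') →
      y = y' := by
  have hC2 : ∀ k, ∀ xk ∈ M k, ∀ w ∈ closure Z, ContDiffAt ℝ 2
      (fun p : (Fin n → ℝ) × (Fin n → ℝ) => f k p.1 p.2) (xk, w) := by
    intro k xk hxk w hw
    obtain ⟨U, hU, hsub, hcd⟩ := hf k
    exact hcd.contDiffAt (hU.mem_nhds (hsub ⟨subset_closure hxk, hw⟩))
  have hstrict : ∀ k, ∀ xk ∈ M k, ∀ w ∈ closure Z, HasStrictFDerivAt
      (fun p : (Fin n → ℝ) × (Fin n → ℝ) => f k p.1 p.2)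
      (fderiv ℝ (fun p : (Fin n → ℝ) × (Fin n → ℝ) => f k p.1 p.2) (xk, w)) (xk, w) :=
    fun k xk hxk w hw => (hC2 k xk hxk w hw).hasStrictFDerivAt (by norm_num)
  -- The derivative of the total cost in all variables.
  let Φ (x : Fin m → Fin n → ℝ) (w : Fin n → ℝ) :
      (Fin m → Fin n → ℝ) × (Fin n → ℝ) →L[ℝ] ℝ :=
    ∑ k, (fderiv ℝ (fun p : (Fin n → ℝ) × (Fin n → ℝ) => f k p.1 p.2) (x k, w)).comp
      (((ContinuousLinearMap.proj k).comp (ContinuousLinearMap.fst ℝ _ _)).prod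
        (ContinuousLinearMap.snd ℝ _ _))
  have hΦ : ∀ x : Fin m → Fin n → ℝ, (∀ k, x k ∈ M k) → ∀ w ∈ closure Z,
      HasStrictFDerivAt (fun p : (Fin m → Fin n → ℝ) × (Fin n → ℝ) => ∑ k, f k (p.1 k) p.2)
        (Φ x w) (x, w) := by
    intro x hx w hw
    refine HasStrictFDerivAt.fun_sum fun k _ => ?_
    let P : (Fin m → Fin n → ℝ) × (Fin n → ℝ) →L[ℝ] (Fin n → ℝ) × (Fin n → ℝ) :=
      ((ContinuousLinearMap.proj k).comp (ContinuousLinearMap.fst ℝ _ _)).prod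
        (ContinuousLinearMap.snd ℝ _ _)
    exact HasStrictFDerivAt.comp (f := P) (x, w) (hstrict k (x k) (hx k) w hw) P.hasStrictFDerivAt
  have hopen : ∀ x : Fin m → Fin n → ℝ, (∀ k, x k ∈ M k) →
      ∀ᶠ x' in 𝓝 x, ∀ k, x' k ∈ M k := fun x hx =>
    eventually_all.2 fun k => (continuous_apply k).continuousAt.eventually
      ((hMo k).mem_nhds (hx k))
  have hc : ∀ x : Fin m → Fin n → ℝ, (∀ k, x k ∈ M k) → c x = ∑ k, f k (x k) (zmin x) := by
    intro x hx
    rw [hcdef]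
    refine IsLeast.csInf_eq ⟨⟨zmin x, subset_closure (hzZ x hx), rfl⟩, ?_⟩
    rintro r ⟨w, hw, rfl⟩
    exact hzmin x hx w hw
  have hpgrad : ∀ x : Fin m → Fin n → ℝ, (∀ k, x k ∈ M k) →
      pgrad c i x = gradX (f i) (x i) (zmin x) := by
    intro x hx
    have hz := subset_closure (hzZ x hx)
    have hmin : ∀ᶠ x' in 𝓝 x, ∑ k, f k (x' k) (zmin x') ≤ ∑ k, f k (x' k) (zmin x) :=
      (hopen x hx).mono fun x' hx' => hzmin x' hx' _ hz
    have hcont : ContinuousAt zmin x := continuousAt_of_unique_min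
      (F := fun p : (Fin m → Fin n → ℝ) × (Fin n → ℝ) => ∑ k, f k (p.1 k) p.2)
      hZb.isCompact_closure (fun w hw => (hΦ x hx w hw).hasFDerivAt.continuousAt)
      ((hopen x hx).mono fun x' hx' => subset_closure (hzZ x' hx')) hmin
      fun w hw hle => hzuniq x hx w hw (le_antisymm hle (hzmin x hx w hw))
    have hd := hasFDerivAt_of_envelope (hΦ x hx _ hz) hcont ((hopen x hx).mono hc) hmin
      ((hopen x hx).mono fun x' hx' => hzmin x hx _ (subset_closure (hzZ x' hx')))
    have hp : HasFDerivAt (fun y => f i y (zmin x)) _ (x i) :=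
      HasFDerivAt.comp (g := fun p : (Fin n → ℝ) × (Fin n → ℝ) => f i p.1 p.2)
        (f := fun y => (y, zmin x)) (x i)
        (hstrict i (x i) (hx i) _ hz).hasFDerivAt (hasFDerivAt_prodMk_left (x i) (zmin x))
    ext a
    rw [pgrad, gradX, hd.fderiv, hp.fderiv]
    simp only [Φ, ContinuousLinearMap.comp_apply, _root_.sum_apply,
      ContinuousLinearMap.inl_apply, ContinuousLinearMap.prod_apply,
      ContinuousLinearMap.coe_fst', ContinuousLinearMap.coe_snd', ContinuousLinearMap.proj_apply]
    rw [Finset.sum_eq_single i, Pi.single_eq_same]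
    · intro k _ hk
      rw [Pi.single_eq_of_ne hk]
      exact map_zero _
    · simp
  have hfoc : ∀ x : Fin m → Fin n → ℝ, (∀ k, x k ∈ M k) →
      ∑ k, gradZ (f k) (x k) (zmin x) = 0 := by
    intro x hx
    have hz := subset_closure (hzZ x hx)
    have hd : ∀ k, DifferentiableAt ℝ (fun w => f k (x k) w) (zmin x) := fun k =>
      (HasFDerivAt.comp (g := fun p : (Fin n → ℝ) × (Fin n → ℝ) => f k p.1 p.2) (zmin x)
        (hstrict k (x k) (hx k) _ hz).hasFDerivAt
        (hasFDerivAt_prodMk_right (x k) (zmin x))).differentiableAt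
    have hmin : IsLocalMin (fun w => ∑ k, f k (x k) w) (zmin x) :=
      mem_of_superset (hZo.mem_nhds (hzZ x hx)) fun w hw => hzmin x hx w (subset_closure hw)
    have h0 := hmin.fderiv_eq_zero
    rw [fderiv_fun_sum fun k _ => hd k] at h0
    ext a
    simpa [gradZ] using DFunLike.congr_fun h0 (Pi.single a 1)
  intro x hx y hy y' hy' h
  have hup : ∀ y ∈ M j, ∀ k, Function.update x j y k ∈ M k := by
    intro y hy k
    rcases eq_or_ne k j with rfl | hk
    · simpa using hy
    · simpa [hk] using hx k
  have hX := hup y hy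
  have hX' := hup y' hy'
  rw [hpgrad _ hX, hpgrad _ hX', Function.update_of_ne hij, Function.update_of_ne hij] at h
  have hzz := hfi _ (hx i) _ (hzZ _ hX) _ (hzZ _ hX') h
  have e := hfoc _ hX
  have e' := hfoc _ hX'
  rw [← hzz] at e'
  rw [← Finset.add_sum_erase _ _ (Finset.mem_univ j), Function.update_self] at e e'
  refine hfj _ (hzZ _ hX) y hy y' hy' (add_right_cancel (e.trans (e'.symm.trans ?_)))
  congr 1
  refine Finset.sum_congr rfl fun k hk => ?_
  rw [Function.update_of_ne (Finset.ne_of_mem_erase hk),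
    Function.update_of_ne (Finset.ne_of_mem_erase hk)]
end

section
/- Let M₁,...,Mₘ be bounded open subsets of ℝⁿ and Z a bounded open subset of ℝⁿ; let each f_k : cl(M_k) × cl(Z) → ℝ be C², and suppose that for every x ∈ M₁×⋯×Mₘ the function z ↦ Σ_k f_k(x_k,z) attains its infimum over cl(Z) at a unique point z(x) ∈ Z with A(x) = Σ_k D²_{zz}f_k(x_k, z(x)) invertible. Define c(x₁,...,xₘ) = inf_{z∈cl(Z)} Σ_k f_k(x_k,z). Then: (a) A(x) is symmetric positive definite for every x; (b) the map x ↦ z(x) is continuously differentiable with D_{xᵢ}z(x) = −A(x)⁻¹ D²_{z xᵢ}fᵢ(xᵢ, z(x)); (c) for every i, D²_{xᵢxᵢ}c(x) = −D²_{xᵢ z}fᵢ · A(x)⁻¹ · D²_{z xᵢ}fᵢ + D²_{xᵢxᵢ}fᵢ, evaluated at (xᵢ, z(x)); and (d) for every i ≠ j, D²_{xᵢxⱼ}c(x) = −D²_{xᵢ z}fᵢ(xᵢ,z(x)) · A(x)⁻¹ · D²_{z xⱼ}fⱼ(xⱼ,z(x)). -/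
open MeasureTheory Finset Matrix

/-- `(D2zx f xi z) a b = ∂²f/∂zₐ ∂xᵢ_b` at `(xi, z)`. -/
noncomputable def D2zx {n : ℕ} (f : (Fin n → ℝ) → (Fin n → ℝ) → ℝ)
    (xi z : Fin n → ℝ) : Matrix (Fin n) (Fin n) ℝ :=
  Matrix.of fun a b =>
    fderiv ℝ (fun w => fderiv ℝ (fun y => f y w) xi (Pi.single b 1)) z
      (Pi.single a 1)

/-- `(D2xz f xi z) a b = ∂²f/∂xᵢₐ ∂z_b` at `(xi, z)`. -/
noncomputable def D2xz {n : ℕ} (f : (Fin n → ℝ) → (Fin n → ℝ) → ℝ)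
    (xi z : Fin n → ℝ) : Matrix (Fin n) (Fin n) ℝ :=
  Matrix.of fun a b =>
    fderiv ℝ (fun y => fderiv ℝ (fun w => f y w) z (Pi.single b 1)) xi
      (Pi.single a 1)

/-- `(D2xx f xi z) a b = ∂²f/∂xᵢₐ ∂xᵢ_b` at `(xi, z)`. -/
noncomputable def D2xx {n : ℕ} (f : (Fin n → ℝ) → (Fin n → ℝ) → ℝ)
    (xi z : Fin n → ℝ) : Matrix (Fin n) (Fin n) ℝ :=
  Matrix.of fun a b =>
    fderiv ℝ (fun y => fderiv ℝ (fun y' => f y' z) y (Pi.single b 1)) xi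
      (Pi.single a 1)

open Filter Topology

section SecondPartials

variable {n : ℕ} {f : (Fin n → ℝ) → (Fin n → ℝ) → ℝ} {y z : Fin n → ℝ}

lemma ContDiffAt.hasFDerivAt_fderiv_apply {P : Type*} [NormedAddCommGroup P] [NormedSpace ℝ P]
    {F : P → ℝ} {p : P} (hF : ContDiffAt ℝ 2 F p) (v : P) :
    HasFDerivAt (fun q => fderiv ℝ F q v) ((fderiv ℝ (fderiv ℝ F) p).flip v) p := by
  have h : DifferentiableAt ℝ (fderiv ℝ F) p :=
    (hF.fderiv_right (m := 1) (by norm_num)).differentiableAt one_ne_zero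
  simpa using h.hasFDerivAt.clm_apply (hasFDerivAt_const v p)

lemma fderiv_partial_right (hf : DifferentiableAt ℝ (Function.uncurry f) (y, z)) (v : Fin n → ℝ) :
    fderiv ℝ (fun w => f y w) z v = fderiv ℝ (Function.uncurry f) (y, z) (0, v) := by
  have h := HasFDerivAt.comp z hf.hasFDerivAt (hasFDerivAt_prodMk_right (𝕜 := ℝ) y z)
  have h' : HasFDerivAt (fun w => f y w) _ z := h
  simp [h'.fderiv]

lemma fderiv_partial_left (hf : DifferentiableAt ℝ (Function.uncurry f) (y, z)) (v : Fin n → ℝ) :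
    fderiv ℝ (fun y => f y z) y v = fderiv ℝ (Function.uncurry f) (y, z) (v, 0) := by
  have h := HasFDerivAt.comp y hf.hasFDerivAt (hasFDerivAt_prodMk_left (𝕜 := ℝ) y z)
  have h' : HasFDerivAt (fun y => f y z) _ y := h
  simp [h'.fderiv]

lemma ContDiffAt.eventually_differentiableAt {P : Type*} [NormedAddCommGroup P] [NormedSpace ℝ P]
    {F : P → ℝ} {p : P} (hF : ContDiffAt ℝ 2 F p) :
    ∀ᶠ q in 𝓝 p, DifferentiableAt ℝ F q :=
  (hF.eventually (by simp)).mono fun _ h => h.differentiableAt two_ne_zero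

lemma D2zz_apply (hf : ContDiffAt ℝ 2 (Function.uncurry f) (y, z)) (a b : Fin n) :
    D2zz f y z a b = fderiv ℝ (fderiv ℝ (Function.uncurry f)) (y, z)
      (0, Pi.single a 1) (0, Pi.single b 1) := by
  have hc : Tendsto (fun w => (y, w)) (𝓝 z) (𝓝 (y, z)) :=
    (Continuous.prodMk_right y).continuousAt
  have he := (hc.eventually hf.eventually_differentiableAt).mono fun w hw =>
    fderiv_partial_right hw (Pi.single b 1)
  have h := (hf.hasFDerivAt_fderiv_apply (0, Pi.single b 1)).comp z
    (hasFDerivAt_prodMk_right (𝕜 := ℝ) y z)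
  rw [D2zz, Matrix.of_apply, EventuallyEq.fderiv_eq he]
  refine (congrArg (fun L => L (Pi.single a 1)) h.fderiv).trans ?_
  simp

lemma D2zx_apply (hf : ContDiffAt ℝ 2 (Function.uncurry f) (y, z)) (a b : Fin n) :
    D2zx f y z a b = fderiv ℝ (fderiv ℝ (Function.uncurry f)) (y, z)
      (0, Pi.single a 1) (Pi.single b 1, 0) := by
  have hc : Tendsto (fun w => (y, w)) (𝓝 z) (𝓝 (y, z)) :=
    (Continuous.prodMk_right y).continuousAt
  have he := (hc.eventually hf.eventually_differentiableAt).mono fun w hw =>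
    fderiv_partial_left hw (Pi.single b 1)
  have h := (hf.hasFDerivAt_fderiv_apply (Pi.single b 1, 0)).comp z
    (hasFDerivAt_prodMk_right (𝕜 := ℝ) y z)
  rw [D2zx, Matrix.of_apply, EventuallyEq.fderiv_eq he]
  refine (congrArg (fun L => L (Pi.single a 1)) h.fderiv).trans ?_
  simp

lemma D2xz_apply (hf : ContDiffAt ℝ 2 (Function.uncurry f) (y, z)) (a b : Fin n) :
    D2xz f y z a b = fderiv ℝ (fderiv ℝ (Function.uncurry f)) (y, z)
      (Pi.single a 1, 0) (0, Pi.single b 1) := by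
  have hc : Tendsto (fun y => (y, z)) (𝓝 y) (𝓝 (y, z)) :=
    (Continuous.prodMk_left z).continuousAt
  have he := (hc.eventually hf.eventually_differentiableAt).mono fun w hw =>
    fderiv_partial_right hw (Pi.single b 1)
  have h := (hf.hasFDerivAt_fderiv_apply (0, Pi.single b 1)).comp y
    (hasFDerivAt_prodMk_left (𝕜 := ℝ) y z)
  rw [D2xz, Matrix.of_apply, EventuallyEq.fderiv_eq he]
  refine (congrArg (fun L => L (Pi.single a 1)) h.fderiv).trans ?_
  simp

lemma D2xx_apply (hf : ContDiffAt ℝ 2 (Function.uncurry f) (y, z)) (a b : Fin n) :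
    D2xx f y z a b = fderiv ℝ (fderiv ℝ (Function.uncurry f)) (y, z)
      (Pi.single a 1, 0) (Pi.single b 1, 0) := by
  have hc : Tendsto (fun y => (y, z)) (𝓝 y) (𝓝 (y, z)) :=
    (Continuous.prodMk_left z).continuousAt
  have he := (hc.eventually hf.eventually_differentiableAt).mono fun w hw =>
    fderiv_partial_left hw (Pi.single b 1)
  have h := (hf.hasFDerivAt_fderiv_apply (Pi.single b 1, 0)).comp y
    (hasFDerivAt_prodMk_left (𝕜 := ℝ) y z)
  rw [D2xx, Matrix.of_apply, EventuallyEq.fderiv_eq he]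
  refine (congrArg (fun L => L (Pi.single a 1)) h.fderiv).trans ?_
  simp

lemma fderiv_fderiv_uncurry_comm (hf : ContDiffAt ℝ 2 (Function.uncurry f) (y, z))
    (u v : (Fin n → ℝ) × (Fin n → ℝ)) :
    fderiv ℝ (fderiv ℝ (Function.uncurry f)) (y, z) u v =
      fderiv ℝ (fderiv ℝ (Function.uncurry f)) (y, z) v u :=
  hf.isSymmSndFDerivAt (by simp) u v

lemma D2zz_transpose (hf : ContDiffAt ℝ 2 (Function.uncurry f) (y, z)) :
    (D2zz f y z)ᵀ = D2zz f y z := by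
  ext a b
  rw [transpose_apply, D2zz_apply hf, D2zz_apply hf, fderiv_fderiv_uncurry_comm hf]

lemma D2zx_transpose (hf : ContDiffAt ℝ 2 (Function.uncurry f) (y, z)) :
    (D2zx f y z)ᵀ = D2xz f y z := by
  ext a b
  rw [transpose_apply, D2zx_apply hf, D2xz_apply hf, fderiv_fderiv_uncurry_comm hf]

lemma map_eq_sum_smul_single {E : Type*} [AddCommGroup E] [Module ℝ E]
    (L : (Fin n → ℝ) →ₗ[ℝ] E) (v : Fin n → ℝ) :
    L v = ∑ a, v a • L (Pi.single a 1) := by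
  conv_lhs => rw [pi_eq_sum_univ' v]
  simp [map_sum]

lemma D2zz_mulVec_apply (hf : ContDiffAt ℝ 2 (Function.uncurry f) (y, z)) (v : Fin n → ℝ)
    (a : Fin n) :
    (D2zz f y z *ᵥ v) a = fderiv ℝ (fderiv ℝ (Function.uncurry f)) (y, z)
      (0, Pi.single a 1) (0, v) := by
  have h := map_eq_sum_smul_single
    ((fderiv ℝ (fderiv ℝ (Function.uncurry f)) (y, z) (0, Pi.single a 1)) ∘L
      .inr ℝ (Fin n → ℝ) (Fin n → ℝ)).toLinearMap v
  simp only [ContinuousLinearMap.coe_coe, ContinuousLinearMap.comp_apply,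
    ContinuousLinearMap.inr_apply, smul_eq_mul] at h
  rw [h]
  simp only [mulVec, dotProduct, D2zz_apply hf, mul_comm]

end SecondPartials

/-- The second-order necessary condition at an interior minimum. -/
lemma IsLocalMin.fderiv_fderiv_nonneg {P : Type*} [NormedAddCommGroup P] [NormedSpace ℝ P]
    {h : P → ℝ} {p : P} (hmin : IsLocalMin h p) (hh : ContDiffAt ℝ 2 h p) (v : P) :
    0 ≤ fderiv ℝ (fderiv ℝ h) p v v := by
  by_contra! hneg
  set φ : ℝ → ℝ := fun t => h (p + t • v)
  have hline : ∀ t : ℝ, HasDerivAt (fun t : ℝ => p + t • v) v t := fun t => by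
    simpa using ((hasDerivAt_id t).smul_const v).const_add p
  have hc : Tendsto (fun t : ℝ => p + t • v) (𝓝 0) (𝓝 p) := by
    simpa using (hline 0).continuousAt.tendsto
  have hderiv : deriv φ =ᶠ[𝓝 0] fun t => fderiv ℝ h (p + t • v) v :=
    (hc.eventually hh.eventually_differentiableAt).mono fun t ht =>
      (ht.hasFDerivAt.comp_hasDerivAt t (hline t)).deriv
  have hdd : deriv (deriv φ) 0 = fderiv ℝ (fderiv ℝ h) p v v := by
    rw [hderiv.deriv_eq]
    have := HasFDerivAt.comp_hasDerivAt_of_eq (0 : ℝ) (hh.hasFDerivAt_fderiv_apply v) (hline 0)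
      (by simp)
    exact this.deriv
  have hd0 : deriv φ 0 = 0 := by
    rw [hderiv.eq_of_nhds]
    simp [hmin.fderiv_eq_zero]
  have hφc : ContinuousAt φ 0 := by
    refine ContinuousAt.comp_of_eq (y := p) hh.continuousAt (hline 0).continuousAt (by simp)
  have hmax := isLocalMax_of_deriv_deriv_neg (hdd ▸ hneg) hd0 hφc
  have hmin' : ∀ᶠ t in 𝓝 (0 : ℝ), φ 0 ≤ φ t := by
    simpa [φ] using hc.eventually hmin
  have hconst : φ =ᶠ[𝓝 0] fun _ => φ 0 := by
    filter_upwards [hmax, hmin'] with t h1 h2 using le_antisymm h1 h2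
  have : deriv (deriv φ) 0 = 0 := by
    rw [hconst.deriv.deriv_eq]; simp
  linarith [hdd ▸ this]

/-- A unique minimizer over a compact set depends continuously on the parameter. -/
lemma continuousAt_of_unique_minimizer {X W : Type*} [TopologicalSpace X] [TopologicalSpace W]
    {K : Set W} (hK : IsCompact K) {g : X → W → ℝ} {ζ : X → W} {x : X}
    (hg : ∀ w ∈ K, ContinuousAt (Function.uncurry g) (x, w))
    (hζ : ∀ᶠ y in 𝓝 x, ζ y ∈ K ∧ ∀ w ∈ K, g y (ζ y) ≤ g y w)
    (huniq : ∀ w ∈ K, g x w = g x (ζ x) → w = ζ x) :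
    ContinuousAt ζ x := by
  have hx := hζ.self_of_nhds
  refine hK.tendsto_nhds_of_unique_mapClusterPt (hζ.mono fun y hy => hy.1) fun w hw hcl => ?_
  refine huniq w hw (le_antisymm ?_ (hx.2 w hw))
  by_contra! hlt
  obtain ⟨r, hr1, hr2⟩ := exists_between hlt
  have h1 : ∀ᶠ p in 𝓝 x ×ˢ 𝓝 w, r < Function.uncurry g p := by
    rw [← nhds_prod_eq]
    exact (hg w hw).eventually (lt_mem_nhds hr2)
  have h2 : ∀ᶠ y in 𝓝 x, g y (ζ x) < r := by
    have : ContinuousAt (fun y => g y (ζ x)) x :=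
      ContinuousAt.comp (f := fun y => (y, ζ x)) (hg _ hx.1) (Continuous.prodMk_left _).continuousAt
    exact this.eventually (gt_mem_nhds hr1)
  obtain ⟨p, hp, q, hq, hpq⟩ := eventually_prod_iff.1 h1
  obtain ⟨y, hqy, hpy, hy2, hyζ⟩ := ((hcl.frequently hq).and_eventually
    (hp.and (h2.and hζ))).exists
  have := hpq hpy hqy
  have h3 := hyζ.2 _ hx.1
  simp only [Function.uncurry_apply_pair] at this
  linarith

/-- A continuous solution of a nondegenerate `C¹` equation is `C¹`. -/
lemma contDiffAt_of_implicit_equation {X W : Type*} [NormedAddCommGroup X] [NormedSpace ℝ X]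
    [CompleteSpace X] [NormedAddCommGroup W] [NormedSpace ℝ W] [FiniteDimensional ℝ W]
    {g : X × W → W} {ζ : X → W} {x : X} (hg : ContDiffAt ℝ 1 g (x, ζ x))
    (hinj : ∀ v, fderiv ℝ g (x, ζ x) (0, v) = 0 → v = 0)
    (hζ : ContinuousAt ζ x) (heq : ∀ᶠ y in 𝓝 x, g (y, ζ y) = 0) :
    ContDiffAt ℝ 1 ζ x := by
  have : CompleteSpace W := FiniteDimensional.complete ℝ W
  have hinv : (fderiv ℝ g (x, ζ x) ∘L .inr ℝ X W).IsInvertible := by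
    set L := fderiv ℝ g (x, ζ x) ∘L .inr ℝ X W
    have hL : Function.Injective L.toLinearMap :=
      (injective_iff_map_eq_zero _).2 fun v hv => hinj v (by simpa [L] using hv)
    refine ⟨(LinearEquiv.ofInjectiveEndo L.toLinearMap hL).toContinuousLinearEquiv, ?_⟩
    ext v
    simp
  refine (hg.contDiffAt_implicitFunction one_ne_zero hinv).congr_of_eventuallyEq ?_
  have ht : Tendsto (fun y => (y, ζ y)) (𝓝 x) (𝓝 (x, ζ x)) :=
    (continuousAt_id.prodMk hζ)
  filter_upwards [ht.eventually (hg.eventually_apply_eq_iff_implicitFunction one_ne_zero hinv),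
    heq] with y h1 h2
  exact (h1.1 (by rw [h2, heq.self_of_nhds])).symm

section Envelope

variable {m n : ℕ} {f : Fin m → (Fin n → ℝ) → (Fin n → ℝ) → ℝ} {x : Fin m → Fin n → ℝ}

lemma hasFDerivAt_fderiv_along {ζ : (Fin m → Fin n → ℝ) → Fin n → ℝ} {k : Fin m}
    (hf : ContDiffAt ℝ 2 (Function.uncurry (f k)) (x k, ζ x)) (hζ : DifferentiableAt ℝ ζ x)
    (v : (Fin n → ℝ) × (Fin n → ℝ)) :
    HasFDerivAt (fun y => fderiv ℝ (Function.uncurry (f k)) (y k, ζ y) v)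
      ((fderiv ℝ (fderiv ℝ (Function.uncurry (f k))) (x k, ζ x)).flip v ∘L
        (ContinuousLinearMap.proj k).prod (fderiv ℝ ζ x)) x :=
  HasFDerivAt.comp (f := fun y : Fin m → Fin n → ℝ => (y k, ζ y)) x (hf.hasFDerivAt_fderiv_apply v)
    ((hasFDerivAt_apply k x).prodMk hζ.hasFDerivAt)

/-- The gradient in `w` of `∑ k, f k (y k) w`. -/
noncomputable def totalGrad (f : Fin m → (Fin n → ℝ) → (Fin n → ℝ) → ℝ)
    (p : (Fin m → Fin n → ℝ) × (Fin n → ℝ)) : Fin n → ℝ :=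
  fun b => ∑ k, fderiv ℝ (Function.uncurry (f k)) (p.1 k, p.2) (0, Pi.single b 1)

lemma contDiffAt_totalGrad {z : Fin n → ℝ}
    (hf : ∀ k, ContDiffAt ℝ 2 (Function.uncurry (f k)) (x k, z)) :
    ContDiffAt ℝ 1 (totalGrad f) (x, z) := by
  refine contDiffAt_pi.2 fun b => ContDiffAt.sum fun k _ => ?_
  have h1 : ContDiffAt ℝ 1 (fun q => fderiv ℝ (Function.uncurry (f k)) q (0, Pi.single b 1))
      (x k, z) :=
    ((hf k).fderiv_right (m := 1) (by norm_num)).clm_apply contDiffAt_const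
  have h2 : ContDiffAt ℝ 1 (fun p : (Fin m → Fin n → ℝ) × (Fin n → ℝ) => (p.1 k, p.2)) (x, z) := by
    fun_prop
  exact ContDiffAt.comp (x, z) (f := fun p : (Fin m → Fin n → ℝ) × (Fin n → ℝ) => (p.1 k, p.2))
    h1 h2

lemma fderiv_totalGrad_inr {z : Fin n → ℝ}
    (hf : ∀ k, ContDiffAt ℝ 2 (Function.uncurry (f k)) (x k, z)) (v : Fin n → ℝ) :
    fderiv ℝ (totalGrad f) (x, z) (0, v) = (∑ k, D2zz (f k) (x k) z) *ᵥ v := by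
  have hd : HasFDerivAt (totalGrad f) (ContinuousLinearMap.pi fun b => ∑ k,
      (fderiv ℝ (fderiv ℝ (Function.uncurry (f k))) (x k, z)).flip (0, Pi.single b 1) ∘L
        ((ContinuousLinearMap.proj k).prodMap (.id ℝ (Fin n → ℝ)))) (x, z) := by
    refine hasFDerivAt_pi.2 fun b => HasFDerivAt.fun_sum fun k _ => ?_
    exact HasFDerivAt.comp (f := fun p : (Fin m → Fin n → ℝ) × (Fin n → ℝ) => (p.1 k, p.2)) (x, z)
      ((hf k).hasFDerivAt_fderiv_apply _)
      (((ContinuousLinearMap.proj k : (Fin m → Fin n → ℝ) →L[ℝ] Fin n → ℝ).prodMap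
        (.id ℝ (Fin n → ℝ))).hasFDerivAt)
  ext b
  rw [hd.fderiv, sum_mulVec, Finset.sum_apply]
  simp only [ContinuousLinearMap.coe_pi', FunLike.coe_sum, Finset.sum_apply]
  refine Finset.sum_congr rfl fun k _ => ?_
  rw [D2zz_mulVec_apply (hf k), fderiv_fderiv_uncurry_comm (hf k)]
  simp

lemma sum_fderiv_inr_eq_zero {z : Fin n → ℝ} (h : totalGrad f (x, z) = 0) (v : Fin n → ℝ) :
    ∑ k, fderiv ℝ (Function.uncurry (f k)) (x k, z) (0, v) = 0 := by
  have h' := map_eq_sum_smul_single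
    ((∑ k, fderiv ℝ (Function.uncurry (f k)) (x k, z)) ∘L
      .inr ℝ (Fin n → ℝ) (Fin n → ℝ)).toLinearMap v
  simp only [ContinuousLinearMap.coe_coe, ContinuousLinearMap.comp_apply,
    ContinuousLinearMap.inr_apply, FunLike.coe_sum, Finset.sum_apply] at h'
  rw [h']
  exact Finset.sum_eq_zero fun b _ => by rw [show ∑ k, _ = _ from congrFun h b]; simp

lemma totalGrad_eq_zero_of_isLocalMin {z : Fin n → ℝ}
    (hf : ∀ k, DifferentiableAt ℝ (Function.uncurry (f k)) (x k, z))
    (hmin : IsLocalMin (fun w => ∑ k, f k (x k) w) z) : totalGrad f (x, z) = 0 := by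
  have hd : ∀ k, DifferentiableAt ℝ (fun w => f k (x k) w) z := fun k =>
    DifferentiableAt.comp (f := fun w => (x k, w)) z (hf k) (by fun_prop)
  ext b
  have h := congrArg (fun L => L (Pi.single b 1)) hmin.fderiv_eq_zero
  simp only [fderiv_fun_sum fun k _ => hd k, FunLike.coe_sum, Finset.sum_apply,
    fderiv_partial_right (hf _)] at h
  exact h

lemma dotProduct_sum_D2zz_mulVec_nonneg {z : Fin n → ℝ}
    (hf : ∀ k, ContDiffAt ℝ 2 (Function.uncurry (f k)) (x k, z))
    (hmin : IsLocalMin (fun w => ∑ k, f k (x k) w) z) (v : Fin n → ℝ) :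
    0 ≤ v ⬝ᵥ ((∑ k, D2zz (f k) (x k) z) *ᵥ v) := by
  have hd : ∀ k, ContDiffAt ℝ 2 (fun w => f k (x k) w) z := fun k =>
    ContDiffAt.comp (f := fun w => (x k, w)) z (hf k) (by fun_prop)
  have hs : ContDiffAt ℝ 2 (fun w => ∑ k, f k (x k) w) z := ContDiffAt.sum fun k _ => hd k
  have h := hmin.fderiv_fderiv_nonneg hs v
  have hD : ∀ᶠ w in 𝓝 z, ∀ k, DifferentiableAt ℝ (Function.uncurry (f k)) (x k, w) :=
    eventually_all.2 fun k =>
      ((Continuous.prodMk_right (x k)).continuousAt.tendsto).eventually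
        (hf k).eventually_differentiableAt
  have he : (fun w => fderiv ℝ (fun w => ∑ k, f k (x k) w) w v) =ᶠ[𝓝 z]
      fun w => v ⬝ᵥ totalGrad f (x, w) := by
    filter_upwards [hD] with w hw
    have hdw : ∀ k, DifferentiableAt ℝ (fun w => f k (x k) w) w := fun k =>
      DifferentiableAt.comp (f := fun w => (x k, w)) w (hw k) (by fun_prop)
    have h' := map_eq_sum_smul_single (fderiv ℝ (fun w => ∑ k, f k (x k) w) w).toLinearMap v
    simp only [ContinuousLinearMap.coe_coe, fderiv_fun_sum fun k _ => hdw k, FunLike.coe_sum,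
      Finset.sum_apply, fderiv_partial_right (hw _), smul_eq_mul] at h' ⊢
    exact h'
  have hg : HasFDerivAt (fun w => totalGrad f (x, w))
      (fderiv ℝ (totalGrad f) (x, z) ∘L .inr ℝ _ _) z :=
    ((contDiffAt_totalGrad hf).differentiableAt one_ne_zero).hasFDerivAt.comp z
      (hasFDerivAt_prodMk_right (𝕜 := ℝ) x z)
  have hdot : HasFDerivAt (fun w => v ⬝ᵥ totalGrad f (x, w))
      (∑ b, v b • (ContinuousLinearMap.proj b ∘L fderiv ℝ (totalGrad f) (x, z) ∘L .inr ℝ _ _)) z :=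
    HasFDerivAt.fun_sum fun b _ => (hasFDerivAt_pi'.1 hg b).const_mul (v b)
  have h2 := (hs.hasFDerivAt_fderiv_apply v).unique (hdot.congr_of_eventuallyEq he)
  have h3 := congrArg (fun L => L v) h2
  simp only [ContinuousLinearMap.flip_apply, FunLike.coe_sum, Finset.sum_apply, FunLike.coe_smul,
    Pi.smul_apply, ContinuousLinearMap.comp_apply, ContinuousLinearMap.inr_apply,
    fderiv_totalGrad_inr hf, ContinuousLinearMap.proj_apply, smul_eq_mul] at h3
  exact h.trans_eq h3

/-- The first-order envelope formula. -/
lemma fderiv_envelope {ζ : (Fin m → Fin n → ℝ) → Fin n → ℝ} {c : (Fin m → Fin n → ℝ) → ℝ}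
    (hf : ∀ k, DifferentiableAt ℝ (Function.uncurry (f k)) (x k, ζ x))
    (hζ : DifferentiableAt ℝ ζ x) (hgrad : totalGrad f (x, ζ x) = 0)
    (hc : c =ᶠ[𝓝 x] fun y => ∑ k, f k (y k) (ζ y)) (j : Fin m) (v : Fin n → ℝ) :
    fderiv ℝ c x (Pi.single j v) = fderiv ℝ (Function.uncurry (f j)) (x j, ζ x) (v, 0) := by
  have hd : HasFDerivAt (fun y => ∑ k, f k (y k) (ζ y))
      (∑ k, fderiv ℝ (Function.uncurry (f k)) (x k, ζ x) ∘L
        (ContinuousLinearMap.proj k).prod (fderiv ℝ ζ x)) x :=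
    HasFDerivAt.fun_sum fun k _ =>
      HasFDerivAt.comp (f := fun y : Fin m → Fin n → ℝ => (y k, ζ y)) x (hf k).hasFDerivAt
        ((hasFDerivAt_apply k x).prodMk hζ.hasFDerivAt)
  rw [hc.fderiv_eq, hd.fderiv]
  have hsplit : ∀ k, fderiv ℝ (Function.uncurry (f k)) (x k, ζ x)
      ((Pi.single j v : Fin m → Fin n → ℝ) k, fderiv ℝ ζ x (Pi.single j v)) =
      fderiv ℝ (Function.uncurry (f k)) (x k, ζ x) ((Pi.single j v : Fin m → Fin n → ℝ) k, 0) +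
      fderiv ℝ (Function.uncurry (f k)) (x k, ζ x) (0, fderiv ℝ ζ x (Pi.single j v)) :=
    fun k => by rw [← map_add]; simp
  simp only [FunLike.coe_sum, Finset.sum_apply, ContinuousLinearMap.comp_apply,
    ContinuousLinearMap.prod_apply, ContinuousLinearMap.proj_apply, hsplit, Finset.sum_add_distrib,
    sum_fderiv_inr_eq_zero hgrad, add_zero]
  rw [Finset.sum_eq_single j (fun k _ hk => by
    rw [Pi.single_eq_of_ne hk]; exact map_zero _) (by simp)]
  simp

/-- The derivative of a solution of the first-order condition. -/
lemma fderiv_of_totalGrad_eq_zero {ζ : (Fin m → Fin n → ℝ) → Fin n → ℝ}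
    (hf : ∀ k, ContDiffAt ℝ 2 (Function.uncurry (f k)) (x k, ζ x))
    (hζ : DifferentiableAt ℝ ζ x) (hgrad : ∀ᶠ y in 𝓝 x, totalGrad f (y, ζ y) = 0)
    (hA : IsUnit (∑ k, D2zz (f k) (x k) (ζ x))) (i : Fin m) :
    (Matrix.of fun a b => fderiv ℝ ζ x (Pi.single i (Pi.single b 1)) a) =
      -((∑ k, D2zz (f k) (x k) (ζ x))⁻¹ * D2zx (f i) (x i) (ζ x)) := by
  set A := ∑ k, D2zz (f k) (x k) (ζ x)
  set J : Matrix (Fin n) (Fin n) ℝ :=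
    Matrix.of fun a b => fderiv ℝ ζ x (Pi.single i (Pi.single b 1)) a
  have key : A * J + D2zx (f i) (x i) (ζ x) = 0 := by
    ext a b
    have hd : HasFDerivAt (fun y => totalGrad f (y, ζ y) a) (∑ k,
        (fderiv ℝ (fderiv ℝ (Function.uncurry (f k))) (x k, ζ x)).flip (0, Pi.single a 1) ∘L
        (ContinuousLinearMap.proj k).prod (fderiv ℝ ζ x)) x :=
      HasFDerivAt.fun_sum fun k _ => hasFDerivAt_fderiv_along (hf k) hζ _
    have h0 : (fun y => totalGrad f (y, ζ y) a) =ᶠ[𝓝 x] fun _ => 0 :=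
      hgrad.mono fun y hy => congrFun hy a
    have h1 := hd.unique ((hasFDerivAt_const (0 : ℝ) x).congr_of_eventuallyEq h0)
    have h2 := congrArg (fun L => L (Pi.single i (Pi.single b 1))) h1
    have hsplit : ∀ k, ∀ u w : Fin n → ℝ,
        fderiv ℝ (fderiv ℝ (Function.uncurry (f k))) (x k, ζ x) (u, w) (0, Pi.single a 1) =
        fderiv ℝ (fderiv ℝ (Function.uncurry (f k))) (x k, ζ x) (0, Pi.single a 1) (u, 0) +
        fderiv ℝ (fderiv ℝ (Function.uncurry (f k))) (x k, ζ x) (0, Pi.single a 1) (0, w) :=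
      fun k u w => by rw [fderiv_fderiv_uncurry_comm (hf k), ← map_add]; simp
    simp only [FunLike.coe_sum, Finset.sum_apply, ContinuousLinearMap.comp_apply,
      ContinuousLinearMap.prod_apply, ContinuousLinearMap.proj_apply,
      ContinuousLinearMap.flip_apply, hsplit, Finset.sum_add_distrib, _root_.zero_apply] at h2
    rw [Finset.sum_eq_single i (fun k _ hk => by
    rw [Pi.single_eq_of_ne hk]; exact map_zero _) (by simp)] at h2
    rw [Matrix.add_apply, Matrix.zero_apply, ← h2, add_comm, D2zx_apply (hf i)]
    congr 1
    · simp
    · change (A *ᵥ fderiv ℝ ζ x (Pi.single i (Pi.single b 1))) a = _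
      simp only [A, sum_mulVec, Finset.sum_apply, D2zz_mulVec_apply (hf _)]
  have hdet := (Matrix.isUnit_iff_isUnit_det A).1 hA
  rw [← Matrix.mul_neg, ← eq_neg_of_add_eq_zero_left key,
    Matrix.nonsing_inv_mul_cancel_left _ _ hdet]

/-- The second-order envelope formula in terms of the derivative of the minimizer. -/
lemma pD2_envelope {ζ : (Fin m → Fin n → ℝ) → Fin n → ℝ} {c : (Fin m → Fin n → ℝ) → ℝ}
    (hf : ∀ k, ContDiffAt ℝ 2 (Function.uncurry (f k)) (x k, ζ x))
    (hζ : DifferentiableAt ℝ ζ x)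
    (hc : ∀ j, ∀ v : Fin n → ℝ, (fun y => fderiv ℝ c y (Pi.single j v)) =ᶠ[𝓝 x]
      fun y => fderiv ℝ (Function.uncurry (f j)) (y j, ζ y) (v, 0)) (i j : Fin m) :
    pD2 c i j x = (Matrix.of fun a b => fderiv ℝ ζ x (Pi.single i (Pi.single b 1)) a)ᵀ *
      D2zx (f j) (x j) (ζ x) + if i = j then D2xx (f j) (x j) (ζ x) else 0 := by
  ext a b
  have h := map_eq_sum_smul_single
    ((fderiv ℝ (fderiv ℝ (Function.uncurry (f j))) (x j, ζ x) (Pi.single b 1, 0)) ∘L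
      .inr ℝ (Fin n → ℝ) (Fin n → ℝ)).toLinearMap (fderiv ℝ ζ x (Pi.single i (Pi.single a 1)))
  simp only [ContinuousLinearMap.coe_coe, ContinuousLinearMap.comp_apply,
    ContinuousLinearMap.inr_apply, smul_eq_mul] at h
  rw [pD2, Matrix.of_apply, (hc j _).fderiv_eq, (hasFDerivAt_fderiv_along (hf j) hζ _).fderiv]
  simp only [ContinuousLinearMap.comp_apply, ContinuousLinearMap.prod_apply,
    ContinuousLinearMap.proj_apply, ContinuousLinearMap.flip_apply]
  rw [fderiv_fderiv_uncurry_comm (hf j), ← Prod.fst_add_snd (Prod.mk _ (fderiv ℝ ζ x _)),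
    map_add, h, add_comm,
    Matrix.add_apply, Matrix.mul_apply]
  congr 1
  · refine Finset.sum_congr rfl fun l _ => ?_
    rw [D2zx_apply (hf j), fderiv_fderiv_uncurry_comm (hf j)]
    rfl
  · split_ifs with hij
    · subst hij
      rw [D2xx_apply (hf i), fderiv_fderiv_uncurry_comm (hf i), Pi.single_eq_same]
    · rw [Pi.single_eq_of_ne (Ne.symm hij)]
      exact map_zero _

end Envelope

/-- **Second-order envelope formulas for the hedonic-pricing cost.** For
`c x = inf_{z ∈ cl Z} Σ_k f k (x k) z` with unique interior minimizer `zmin x`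
and invertible `A x = Σ_k D²_zz f k (x k) (zmin x)`:
(a) `A x` is symmetric positive definite, (b) `zmin` is continuously
differentiable with `D_{x i} zmin = −A⁻¹ D²_{z x i} f i`, and (c), (d) the
second derivatives of `c` are given by the stated formulas. -/
theorem hedonic_second_derivatives {m n : ℕ}
    (M : Fin m → Set (Fin n → ℝ)) (hMo : ∀ i, IsOpen (M i))
    (hMb : ∀ i, Bornology.IsBounded (M i))
    (Z : Set (Fin n → ℝ)) (hZo : IsOpen Z) (hZb : Bornology.IsBounded Z)
    (f : Fin m → (Fin n → ℝ) → (Fin n → ℝ) → ℝ)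
    (hf : ∀ k, ∃ U : Set ((Fin n → ℝ) × (Fin n → ℝ)), IsOpen U ∧
      closure (M k) ×ˢ closure Z ⊆ U ∧
      ContDiffOn ℝ 2 (fun p : (Fin n → ℝ) × (Fin n → ℝ) => f k p.1 p.2) U)
    (zmin : (Fin m → Fin n → ℝ) → Fin n → ℝ)
    (hzZ : ∀ x : Fin m → Fin n → ℝ, (∀ k, x k ∈ M k) → zmin x ∈ Z)
    (hzmin : ∀ x : Fin m → Fin n → ℝ, (∀ k, x k ∈ M k) → ∀ w ∈ closure Z,
      ∑ k, f k (x k) (zmin x) ≤ ∑ k, f k (x k) w)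
    (hzuniq : ∀ x : Fin m → Fin n → ℝ, (∀ k, x k ∈ M k) → ∀ w ∈ closure Z,
      ∑ k, f k (x k) w = ∑ k, f k (x k) (zmin x) → w = zmin x)
    (hA : ∀ x : Fin m → Fin n → ℝ, (∀ k, x k ∈ M k) →
      IsUnit (∑ k, D2zz (f k) (x k) (zmin x)))
    (c : (Fin m → Fin n → ℝ) → ℝ)
    (hcdef : ∀ x, c x = sInf {r : ℝ | ∃ w ∈ closure Z, r = ∑ k, f k (x k) w}) :
    ∀ x : Fin m → Fin n → ℝ, (∀ k, x k ∈ M k) →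
      -- (a) `A x` is symmetric positive definite
      ((∑ k, D2zz (f k) (x k) (zmin x))ᵀ = ∑ k, D2zz (f k) (x k) (zmin x)) ∧
      (∀ v : Fin n → ℝ, v ≠ 0 →
        0 < v ⬝ᵥ ((∑ k, D2zz (f k) (x k) (zmin x)) *ᵥ v)) ∧
      -- (b) `zmin` is continuously differentiable with the stated derivative
      ContDiffAt ℝ 1 zmin x ∧
      (∀ i : Fin m,
        (Matrix.of fun a b =>
            fderiv ℝ (fun y => zmin y a) x (Pi.single i (Pi.single b 1))) =
          -((∑ k, D2zz (f k) (x k) (zmin x))⁻¹ * D2zx (f i) (x i) (zmin x))) ∧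
      -- (c) the unmixed second derivatives of `c`
      (∀ i : Fin m, pD2 c i i x =
        -(D2xz (f i) (x i) (zmin x) * (∑ k, D2zz (f k) (x k) (zmin x))⁻¹ *
            D2zx (f i) (x i) (zmin x))
          + D2xx (f i) (x i) (zmin x)) ∧
      -- (d) the mixed second derivatives of `c`
      (∀ i j : Fin m, i ≠ j → pD2 c i j x =
        -(D2xz (f i) (x i) (zmin x) * (∑ k, D2zz (f k) (x k) (zmin x))⁻¹ *
            D2zx (f j) (x j) (zmin x))) := by
  have hcd : ∀ y : Fin m → Fin n → ℝ, (∀ k, y k ∈ M k) → ∀ w ∈ closure Z, ∀ k,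
      ContDiffAt ℝ 2 (Function.uncurry (f k)) (y k, w) := fun y hy w hw k => by
    obtain ⟨U, hU, hsub, hfU⟩ := hf k
    exact hfU.contDiffAt (hU.mem_nhds (hsub ⟨subset_closure (hy k), hw⟩))
  have hopen : ∀ x : Fin m → Fin n → ℝ, (∀ k, x k ∈ M k) →
      ∀ᶠ y in 𝓝 x, ∀ k, y k ∈ M k := fun x hx =>
    eventually_all.2 fun k => (continuousAt_apply k x).eventually ((hMo k).mem_nhds (hx k))
  have hcd' : ∀ y : Fin m → Fin n → ℝ, (∀ k, y k ∈ M k) → ∀ k,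
      ContDiffAt ℝ 2 (Function.uncurry (f k)) (y k, zmin y) := fun y hy =>
    hcd y hy _ (subset_closure (hzZ y hy))
  have hlocmin : ∀ y : Fin m → Fin n → ℝ, (∀ k, y k ∈ M k) →
      IsLocalMin (fun w => ∑ k, f k (y k) w) (zmin y) := fun y hy =>
    Filter.mem_of_superset (hZo.mem_nhds (hzZ y hy)) fun w hw => hzmin y hy w (subset_closure hw)
  have hgrad : ∀ y : Fin m → Fin n → ℝ, (∀ k, y k ∈ M k) → totalGrad f (y, zmin y) = 0 :=
    fun y hy => totalGrad_eq_zero_of_isLocalMin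
      (fun k => (hcd' y hy k).differentiableAt two_ne_zero) (hlocmin y hy)
  have hc : ∀ y : Fin m → Fin n → ℝ, (∀ k, y k ∈ M k) → c y = ∑ k, f k (y k) (zmin y) :=
    fun y hy => by
      rw [hcdef]
      refine IsLeast.csInf_eq ⟨⟨_, subset_closure (hzZ y hy), rfl⟩, ?_⟩
      rintro r ⟨w, hw, rfl⟩
      exact hzmin y hy w hw
  have hcont : ∀ x : Fin m → Fin n → ℝ, (∀ k, x k ∈ M k) → ContinuousAt zmin x := fun x hx => by
    refine continuousAt_of_unique_minimizer (g := fun y w => ∑ k, f k (y k) w)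
      hZb.isCompact_closure (fun w hw => ?_)
      ((hopen x hx).mono fun y hy => ⟨subset_closure (hzZ y hy), hzmin y hy⟩) (hzuniq x hx)
    refine tendsto_finsetSum _ fun k _ => ?_
    exact ContinuousAt.comp (x := (x, w)) (g := Function.uncurry (f k))
      (f := fun p : (Fin m → Fin n → ℝ) × (Fin n → ℝ) => (p.1 k, p.2))
      (hcd x hx w hw k).continuousAt (by fun_prop)
  have hC1 : ∀ x : Fin m → Fin n → ℝ, (∀ k, x k ∈ M k) → ContDiffAt ℝ 1 zmin x := fun x hx => by
    refine contDiffAt_of_implicit_equation (contDiffAt_totalGrad (hcd' x hx)) (fun v hv => ?_)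
      (hcont x hx) ((hopen x hx).mono hgrad)
    rw [fderiv_totalGrad_inr (hcd' x hx)] at hv
    exact Matrix.mulVec_injective_of_isUnit (hA x hx) (hv.trans (mulVec_zero _).symm)
  intro x hx
  have hsymm : (∑ k, D2zz (f k) (x k) (zmin x))ᵀ = ∑ k, D2zz (f k) (x k) (zmin x) := by
    rw [transpose_sum]
    exact Finset.sum_congr rfl fun k _ => D2zz_transpose (hcd' x hx k)
  have hdiff := (hC1 x hx).differentiableAt one_ne_zero
  have hJ := fderiv_of_totalGrad_eq_zero (hcd' x hx) hdiff ((hopen x hx).mono hgrad) (hA x hx)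
  have henv : ∀ j, ∀ v : Fin n → ℝ, (fun y => fderiv ℝ c y (Pi.single j v)) =ᶠ[𝓝 x]
      fun y => fderiv ℝ (Function.uncurry (f j)) (y j, zmin y) (v, 0) := fun j v =>
    (hopen x hx).mono fun y hy =>
      fderiv_envelope (fun k => (hcd' y hy k).differentiableAt two_ne_zero)
        ((hC1 y hy).differentiableAt one_ne_zero) (hgrad y hy) ((hopen y hy).mono hc) j v
  have hD2 : ∀ i j, pD2 c i j x =
      -(D2xz (f i) (x i) (zmin x) * (∑ k, D2zz (f k) (x k) (zmin x))⁻¹ *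
        D2zx (f j) (x j) (zmin x)) + if i = j then D2xx (f j) (x j) (zmin x) else 0 :=
    fun i j => by
      rw [pD2_envelope (hcd' x hx) hdiff henv, hJ, transpose_neg, transpose_mul,
        D2zx_transpose (hcd' x hx i), transpose_nonsing_inv, hsymm, Matrix.neg_mul]
  refine ⟨hsymm, fun v hv => ?_, hC1 x hx, fun i => ?_, fun i => ?_, fun i j hij => ?_⟩
  · have hpsd : (∑ k, D2zz (f k) (x k) (zmin x)).PosSemidef :=
      .of_dotProduct_mulVec_nonneg (by simpa [IsHermitian] using hsymm)
        (dotProduct_sum_D2zz_mulVec_nonneg (hcd' x hx) (hlocmin x hx))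
    exact (hpsd.posDef_iff_isUnit.2 (hA x hx)).dotProduct_mulVec_pos hv
  · rw [← hJ i]
    ext a b
    exact congrArg (fun L => L (Pi.single i (Pi.single b 1))) (fderiv_apply hdiff a)
  · simpa using hD2 i i
  · simpa [hij] using hD2 i j
end
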